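/- arXiv:2410.13728 — 2 statements merged into one kernel-verified Lean document; each statement's English description precedes it below -/
import Mathlib

section
/- Let A be a Deligne-finite k-linear abelian category over an algebraically closed field k, with a fixed ordering S_1,…,S_n of its simple objects, projective covers P_i and standard objects Δ_i. Then A is highest weight with respect to the given ordering if, and only if, there is a stability function Z : K(A) → ℂ on A such that (a) Δ_1,…,Δ_n are Z-stable with φ(Δ_1) < φ(Δ_2) < … < φ(Δ_n), and (b) for each i = 1,…,n, every Harder–Narasimhan factor of P_i is a direct sum of copies of the standard objects Δ_i,…,Δ_n. -/
open CategoryTheory CategoryTheory.Limits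

attribute [local instance] CategoryTheory.Abelian.hasFiniteBiproducts

universe v u

namespace HWPaper

variable {C : Type u} [Category.{v} C]

/-- `p : P ⟶ X` exhibits `P` as a projective cover of `X`:
`P` is projective, `p` is epi, and `p` is a superfluous epimorphism. -/
def IsProjCover (P X : C) (p : P ⟶ X) : Prop :=
  Projective P ∧ Epi p ∧ ∀ ⦃Y : C⦄ (f : Y ⟶ P), Epi (f ≫ p) → Epi f

/-- `ι : X ⟶ I` exhibits `I` as an injective hull of `X`. -/
def IsInjHull (X I : C) (ι : X ⟶ I) : Prop :=
  Injective I ∧ Mono ι ∧ ∀ ⦃Y : C⦄ (f : I ⟶ Y), Mono (ι ≫ f) → Mono f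

/-- `q : P ⟶ D` exhibits `D` as the maximal quotient of `P` lying in the class `mem`:
every quotient of `P` lying in `mem` factors through `q`. -/
def IsMaxQuotientIn (mem : C → Prop) (P D : C) (q : P ⟶ D) : Prop :=
  Epi q ∧ mem D ∧ ∀ ⦃Q : C⦄ (e : P ⟶ Q), Epi e → mem Q → ∃ r : D ⟶ Q, q ≫ r = e

/-- `m : N ⟶ I` exhibits `N` as the maximal subobject of `I` lying in the class `mem`. -/
def IsMaxSubobjectIn (mem : C → Prop) (I N : C) (m : N ⟶ I) : Prop :=
  Mono m ∧ mem N ∧ ∀ ⦃M : C⦄ (s : M ⟶ I), Mono s → mem M → ∃ r : M ⟶ N, r ≫ m = s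

/-- The extension closure of a class of objects in an abelian category. -/
inductive ExtClosure [Abelian C] (P : C → Prop) : C → Prop
  | of (X : C) : P X → ExtClosure P X
  | zero (X : C) : IsZero X → ExtClosure P X
  | ext (S : ShortComplex C) : S.ShortExact → ExtClosure P S.X₁ → ExtClosure P S.X₃ →
      ExtClosure P S.X₂

variable (C) in
/-- The subgroup of relations coming from short exact sequences. -/
def K0Relations [Abelian C] : AddSubgroup (FreeAbelianGroup C) :=
  AddSubgroup.closure {x | ∃ S : ShortComplex C, S.ShortExact ∧
    x = FreeAbelianGroup.of S.X₂ - FreeAbelianGroup.of S.X₁ - FreeAbelianGroup.of S.X₃}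

variable (C) in
/-- The Grothendieck group of an abelian category. -/
def K0 [Abelian C] : Type u := FreeAbelianGroup C ⧸ K0Relations C

noncomputable instance [Abelian C] : AddCommGroup (K0 C) :=
  QuotientAddGroup.Quotient.addCommGroup _

/-- The class of an object in the Grothendieck group. -/
def K0.cls [Abelian C] (X : C) : K0 C := QuotientAddGroup.mk (FreeAbelianGroup.of X)

/-- The data of a Deligne-finite `k`-linear abelian category with an ordering
`S 0, …, S (n-1)` of its simple objects, together with projective covers, injective hulls,
standard and costandard objects, and the Jordan–Hölder multiplicity function. -/
structure DeligneData (k : Type v) [Field k] [IsAlgClosed k]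
    (C : Type u) [Category.{v} C] [Abelian C] [Linear k C] [EnoughProjectives C]
    (n : ℕ) where
  /-- the simple objects -/
  S : Fin n → C
  /-- the projective covers -/
  P : Fin n → C
  /-- the injective hulls -/
  I : Fin n → C
  /-- the standard objects -/
  Δ : Fin n → C
  /-- the costandard objects -/
  nabla : Fin n → C
  /-- the projective cover maps -/
  p : ∀ i, P i ⟶ S i
  /-- the injective hull maps -/
  ι : ∀ i, S i ⟶ I i
  /-- the quotient maps onto the standard objects -/
  q : ∀ i, P i ⟶ Δ i
  /-- the inclusions of the costandard objects -/
  m : ∀ i, nabla i ⟶ I i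
  /-- the Jordan–Hölder multiplicity `[X : S j]` -/
  mult : C → Fin n → ℕ
  homFinite : ∀ X Y : C, FiniteDimensional k (X ⟶ Y)
  ext1Finite : ∀ X Y : C, FiniteDimensional k (((Ext k C 1).obj (Opposite.op X)).obj Y)
  simple : ∀ i, Simple (S i)
  distinct : ∀ i j, Nonempty (S i ≅ S j) → i = j
  exhaustive : ∀ X : C, Simple X → ∃ i, Nonempty (X ≅ S i)
  projCover : ∀ i, IsProjCover (P i) (S i) (p i)
  injHull : ∀ i, IsInjHull (S i) (I i) (ι i)
  std : ∀ i, IsMaxQuotientIn (ExtClosure (fun X => ∃ j, j ≤ i ∧ Nonempty (X ≅ S j)))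
      (P i) (Δ i) (q i)
  costd : ∀ i, IsMaxSubobjectIn (ExtClosure (fun X => ∃ j, j ≤ i ∧ Nonempty (X ≅ S j)))
      (I i) (nabla i) (m i)
  mult_simple : ∀ i j, mult (S i) j = if i = j then 1 else 0
  mult_additive : ∀ T : ShortComplex C, T.ShortExact →
      ∀ j, mult T.X₂ j = mult T.X₁ j + mult T.X₃ j
  mult_eq_zero_iff : ∀ X : C, (∀ j, mult X j = 0) ↔ IsZero X

variable {k : Type v} [Field k] [IsAlgClosed k] [Abelian C] [Linear k C]
  [EnoughProjectives C] {n : ℕ}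

/-- The Serre subcategory `A_i`, i.e. the extension closure of `S 0, …, S i`. -/
def DeligneData.serre (D : DeligneData k C n) (i : Fin n) : C → Prop :=
  ExtClosure (fun X => ∃ j, j ≤ i ∧ Nonempty (X ≅ D.S j))

/-- `A` is a highest-weight category with respect to the given ordering of its simple
objects: `End (Δ i) ≅ k` and each `P i` lies in the extension closure of `Δ i, …, Δ (n-1)`. -/
def DeligneData.IsHighestWeight (D : DeligneData k C n) : Prop :=
  ∀ i, Nonempty (End (D.Δ i) ≃ₐ[k] k) ∧
    ExtClosure (fun X => ∃ j, i ≤ j ∧ Nonempty (X ≅ D.Δ j)) (D.P i)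


/-- The upper half plane with the positive real axis removed:
`ℍ = { r·exp(iπφ) | r > 0, φ ∈ (0,1] }`, i.e. the set of nonzero complex numbers
whose argument lies in `(0, π]`. -/
def stabilityHalfPlane : Set ℂ := {z | 0 < z.arg}

/-- The phase `φ(z) ∈ (0,1]` of an element `z = r·exp(iπφ(z))` of `ℍ`. -/
noncomputable def phase (z : ℂ) : ℝ := z.arg / Real.pi

/-- A stability function on an abelian category: an additive homomorphism
`Z : K(A) → ℂ` sending every nonzero object into the half plane `ℍ`. -/
def IsStabilityFunction [Abelian C] (Z : K0 C →+ ℂ) : Prop :=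
  ∀ X : C, ¬ IsZero X → Z (K0.cls X) ∈ stabilityHalfPlane

/-- An object is `Z`-semistable if every nonzero proper subobject has phase at most
that of the object. -/
def IsZSemistable [Abelian C] (Z : K0 C →+ ℂ) (X : C) : Prop :=
  ¬ IsZero X ∧ ∀ ⦃Y : C⦄ (f : Y ⟶ X), Mono f → ¬ IsZero Y → ¬ IsIso f →
    phase (Z (K0.cls Y)) ≤ phase (Z (K0.cls X))

/-- An object is `Z`-stable if every nonzero proper subobject has phase strictly less
than that of the object. -/
def IsZStable [Abelian C] (Z : K0 C →+ ℂ) (X : C) : Prop :=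
  ¬ IsZero X ∧ ∀ ⦃Y : C⦄ (f : Y ⟶ X), Mono f → ¬ IsZero Y → ¬ IsIso f →
    phase (Z (K0.cls Y)) < phase (Z (K0.cls X))

/-- A Harder–Narasimhan filtration of `X`: a filtration
`0 = F 0 ⊂ F 1 ⊂ ⋯ ⊂ F d = X` whose factors (the cokernels of the inclusions) are
`Z`-semistable of strictly decreasing phase. -/
structure HNFiltration [Abelian C] (Z : K0 C →+ ℂ) (X : C) where
  /-- the length of the filtration -/
  d : ℕ
  /-- the filtration steps -/
  F : Fin (d + 1) → C
  isZero_bot : IsZero (F 0)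
  top_iso : Nonempty (F (Fin.last d) ≅ X)
  /-- the inclusion maps -/
  f : ∀ l : Fin d, F l.castSucc ⟶ F l.succ
  mono : ∀ l, Mono (f l)
  semistable : ∀ l, IsZSemistable Z (cokernel (f l))
  phases_strictAnti : ∀ l l' : Fin d, l < l' →
    phase (Z (K0.cls (cokernel (f l')))) < phase (Z (K0.cls (cokernel (f l))))

/-! ### Multiplicities -/

theorem DeligneData.mult_isZero (D : DeligneData k C n) {X : C} (h : IsZero X) (j : Fin n) :
    D.mult X j = 0 := (D.mult_eq_zero_iff X).2 h j

theorem DeligneData.mult_mono (D : DeligneData k C n) {X Y : C} (f : X ⟶ Y) [Mono f] (j : Fin n) :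
    D.mult Y j = D.mult X j + D.mult (cokernel f) j :=
  D.mult_additive (ShortComplex.mk f (cokernel.π f) (by simp))
    { exact := ShortComplex.exact_cokernel f } j

theorem DeligneData.mult_epi (D : DeligneData k C n) {X Y : C} (f : X ⟶ Y) [Epi f] (j : Fin n) :
    D.mult X j = D.mult (kernel f) j + D.mult Y j :=
  D.mult_additive (ShortComplex.mk (kernel.ι f) f (by simp))
    { exact := ShortComplex.exact_kernel f } j

theorem DeligneData.mult_iso (D : DeligneData k C n) {X Y : C} (e : X ≅ Y) (j : Fin n) :
    D.mult X j = D.mult Y j := by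
  rw [D.mult_mono e.hom j, D.mult_isZero (isZero_cokernel_of_epi e.hom) j, add_zero]

theorem DeligneData.mult_le_of_mono (D : DeligneData k C n) {X Y : C} (f : X ⟶ Y) [Mono f]
    (j : Fin n) : D.mult X j ≤ D.mult Y j := by
  rw [D.mult_mono f j]; omega

theorem DeligneData.mult_le_of_epi (D : DeligneData k C n) {X Y : C} (f : X ⟶ Y) [Epi f]
    (j : Fin n) : D.mult Y j ≤ D.mult X j := by
  rw [D.mult_epi f j]; omega

/-- length -/
def DeligneData.len (D : DeligneData k C n) (X : C) : ℕ := ∑ j, D.mult X j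

theorem DeligneData.len_eq_zero (D : DeligneData k C n) {X : C} : D.len X = 0 ↔ IsZero X := by
  rw [← D.mult_eq_zero_iff, DeligneData.len, Finset.sum_eq_zero_iff]; simp

theorem DeligneData.len_mono (D : DeligneData k C n) {X Y : C} (f : X ⟶ Y) [Mono f] :
    D.len Y = D.len X + D.len (cokernel f) := by
  simp only [DeligneData.len, D.mult_mono f, Finset.sum_add_distrib]

theorem DeligneData.len_epi (D : DeligneData k C n) {X Y : C} (f : X ⟶ Y) [Epi f] :
    D.len X = D.len (kernel f) + D.len Y := by
  simp only [DeligneData.len, D.mult_epi f, Finset.sum_add_distrib]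

theorem DeligneData.isIso_of_len (D : DeligneData k C n) {X Y : C} (f : X ⟶ Y) [Mono f]
    (h : D.len Y ≤ D.len X) : IsIso f := by
  have h1 := D.len_mono f
  have h2 : IsZero (cokernel f) := D.len_eq_zero.1 (by omega)
  have : Epi f := Preadditive.epi_of_isZero_cokernel f h2
  exact isIso_of_mono_of_epi f

/-- Existence of a simple subobject. -/
theorem DeligneData.exists_simple (D : DeligneData k C n) (X : C) (hX : ¬ IsZero X) :
    ∃ (i : Fin n) (f : D.S i ⟶ X), Mono f := by
  classical
  have hex : ∃ m, ∃ (Y : C) (f : Y ⟶ X), Mono f ∧ ¬ IsZero Y ∧ D.len Y = m :=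
    ⟨_, X, 𝟙 X, inferInstance, hX, rfl⟩
  obtain ⟨Y, f, hf, hY, hm⟩ := Nat.find_spec hex
  have hs : Simple Y := by
    refine ⟨fun {W} g hg => ⟨?_, ?_⟩⟩
    · intro hi h0
      subst h0
      exact hY ((isIsoZeroEquivIsoZero _ _ hi).2.isZero_iff.2 (isZero_zero C))
    · intro hg0
      have hW : ¬ IsZero W := fun h => hg0 (h.eq_zero_of_src g)
      have := Nat.find_min' hex ⟨W, g ≫ f, mono_comp _ _, hW, rfl⟩
      exact D.isIso_of_len g (by omega)
  obtain ⟨i, ⟨e⟩⟩ := D.exhaustive Y hs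
  exact ⟨i, e.inv ≫ f, mono_comp _ _⟩

open ZeroObject in
theorem ExtClosure.iso {Q : C → Prop} {X Y : C} (e : X ≅ Y) (h : ExtClosure Q X) :
    ExtClosure Q Y :=
  ExtClosure.ext (ShortComplex.mk e.hom (0 : Y ⟶ (0 : C)) (by simp))
    { exact := by
        rw [ShortComplex.exact_iff_epi _ rfl]; dsimp; infer_instance
      epi_g := ⟨fun _ _ _ => (isZero_zero C).eq_of_src _ _⟩ }
    h (ExtClosure.zero _ (isZero_zero C))

theorem ExtClosure.mono {Q R : C → Prop} (hQR : ∀ X, Q X → R X) {X : C} (h : ExtClosure Q X) :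
    ExtClosure R X := by
  induction h with
  | of X h => exact .of X (hQR X h)
  | zero X h => exact .zero X h
  | ext S hS _ _ h1 h2 => exact .ext S hS h1 h2

theorem DeligneData.serre_iff (D : DeligneData k C n) (i : Fin n) (X : C) :
    ExtClosure (fun X => ∃ j, j ≤ i ∧ Nonempty (X ≅ D.S j)) X ↔ ∀ j, i < j → D.mult X j = 0 := by
  constructor
  · intro h
    induction h with
    | of X h =>
      obtain ⟨l, hl, ⟨e⟩⟩ := h
      intro j hj
      rw [D.mult_iso e, D.mult_simple, if_neg]
      rintro rfl
      exact absurd hl (not_le.2 hj)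
    | zero X h => intro j _; exact D.mult_isZero h j
    | ext S hS _ _ h1 h2 =>
      intro j hj
      rw [D.mult_additive S hS, h1 j hj, h2 j hj]
  · intro h
    obtain ⟨m, hm⟩ : ∃ m, D.len X = m := ⟨_, rfl⟩
    induction m using Nat.strong_induction_on generalizing X with
    | _ m ih =>
      by_cases hX : IsZero X
      · exact .zero X hX
      obtain ⟨l, f, hf⟩ := D.exists_simple X hX
      have hl : l ≤ i := by
        by_contra hl
        have h1 := h l (not_le.1 hl)
        have h2 := D.mult_le_of_mono f l
        rw [D.mult_simple, if_pos rfl] at h2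
        omega
      have h1 := D.len_mono f
      have h2 : D.len (D.S l) ≠ 0 := by
        rw [Ne, D.len_eq_zero]
        have := D.simple l
        exact Simple.not_isZero _
      refine .ext (ShortComplex.mk f (cokernel.π f) (by simp))
        { exact := ShortComplex.exact_cokernel f } (.of _ ⟨l, hl, ⟨Iso.refl _⟩⟩) ?_
      refine ih _ (by omega) (cokernel f) ?_ rfl
      intro j hj
      have := D.mult_le_of_epi (cokernel.π f) j
      rw [h j hj] at this
      omega

theorem DeligneData.mult_Δ (D : DeligneData k C n) {i j : Fin n} (h : i < j) :
    D.mult (D.Δ i) j = 0 := (D.serre_iff i _).1 (D.std i).2.1 j h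

/-- Any map from `P i` to an object of `A_i` factors through `Δ i`. -/
theorem DeligneData.factor (D : DeligneData k C n) (i : Fin n) {X : C}
    (hX : ∀ j, i < j → D.mult X j = 0) (u : D.P i ⟶ X) : ∃ r : D.Δ i ⟶ X, D.q i ≫ r = u := by
  obtain ⟨r, hr⟩ := (D.std i).2.2 (Abelian.factorThruImage u) inferInstance
    ((D.serre_iff i _).2 (fun j hj => by
      have := D.mult_le_of_mono (Abelian.image.ι u) j
      rw [hX j hj] at this
      omega))
  exact ⟨r ≫ Abelian.image.ι u, by rw [← Category.assoc, hr]; exact Abelian.image.fac u⟩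

theorem DeligneData.exists_hom (D : DeligneData k C n) (i : Fin n) (X : C)
    (h : D.mult X i ≠ 0) : ∃ u : D.P i ⟶ X, u ≠ 0 := by
  obtain ⟨m, hm⟩ : ∃ m, D.len X = m := ⟨_, rfl⟩
  induction m using Nat.strong_induction_on generalizing X with
  | _ m ih =>
    have hX : ¬ IsZero X := fun hX => h (D.mult_isZero hX i)
    obtain ⟨l, f, hf⟩ := D.exists_simple X hX
    have := D.simple l
    by_cases hl : l = i
    · subst hl
      have hp := (D.projCover l).2.1
      refine ⟨D.p l ≫ f, fun h0 => ?_⟩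
      have h1 : f = 0 := by rw [← cancel_epi (D.p l), h0, comp_zero]
      subst h1
      exact id_nonzero (D.S l) (by rw [← cancel_mono (0 : D.S l ⟶ X)]; simp)
    · have h1 := D.len_mono f
      have h2 : D.len (D.S l) ≠ 0 := by
        rw [Ne, D.len_eq_zero]
        exact Simple.not_isZero _
      have h3 := D.mult_mono f i
      rw [D.mult_simple, if_neg hl] at h3
      obtain ⟨u, hu⟩ := ih _ (by omega) (cokernel f) (by omega) rfl
      have := (D.projCover i).1
      refine ⟨Projective.factorThru u (cokernel.π f), fun h0 => hu ?_⟩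
      rw [← Projective.factorThru_comp u (cokernel.π f), h0, zero_comp]

/-- The map `Δ i ⟶ S i`. -/
theorem DeligneData.exists_top (D : DeligneData k C n) (i : Fin n) :
    ∃ r : D.Δ i ⟶ D.S i, D.q i ≫ r = D.p i :=
  D.factor i (fun j hj => by rw [D.mult_simple, if_neg (ne_of_lt hj)]) _

theorem DeligneData.not_isZero_Δ (D : DeligneData k C n) (i : Fin n) : ¬ IsZero (D.Δ i) := by
  intro h
  obtain ⟨r, hr⟩ := D.exists_top i
  have := (D.projCover i).2.1
  have := D.simple i
  rw [h.eq_zero_of_src r, comp_zero] at hr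
  exact id_nonzero (D.S i) (by rw [← cancel_epi (D.p i), ← hr]; simp)

theorem DeligneData.sub_Δ (D : DeligneData k C n) {i : Fin n} (hE : Nonempty (End (D.Δ i) ≃ₐ[k] k))
    {Y : C} (f : Y ⟶ D.Δ i) [Mono f] (hf : ¬ IsIso f) (j : Fin n) (hj : i ≤ j) :
    D.mult Y j = 0 := by
  obtain ⟨e⟩ := hE
  obtain ⟨r, hr⟩ := D.exists_top i
  have hp := (D.projCover i).2.1
  have hs := D.simple i
  have hq := (D.std i).1
  have hre : Epi r := by
    have : Epi (D.q i ≫ r) := by rw [hr]; exact hp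
    exact epi_of_epi (D.q i) r
  rcases hj.lt_or_eq with hj | rfl
  · have := D.mult_le_of_mono f j
    rw [D.mult_Δ hj] at this
    omega
  have hfr : f ≫ r = 0 := by
    by_contra h0
    have h1 : Epi (f ≫ r) := epi_of_nonzero_to_simple h0
    apply hf
    have h2 : Epi (pullback.fst (D.q i) f) := by
      apply (D.projCover i).2.2
      rw [← hr, ← Category.assoc, pullback.condition, Category.assoc]
      exact epi_comp _ _
    have h3 : Epi (pullback.snd (D.q i) f ≫ f) := by
      rw [← pullback.condition]; exact epi_comp _ _
    have : Epi f := epi_of_epi (pullback.snd (D.q i) f) f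
    exact isIso_of_mono_of_epi f
  have hk : D.mult (kernel r) i = 0 := by
    by_contra h0
    obtain ⟨u, hu⟩ := D.exists_hom i _ h0
    obtain ⟨g, hg⟩ := D.factor i (fun j hj => D.mult_Δ hj) (u ≫ kernel.ι r)
    have hg0 : g ≠ 0 := by
      rintro rfl
      apply hu
      rw [← cancel_mono (kernel.ι r), ← hg]; simp
    have hgr : g ≫ r = 0 := by
      rw [← cancel_epi (D.q i), ← Category.assoc, hg]; simp
    let g' : End (D.Δ i) := End.of g
    have hg' : e g' ≠ 0 := by
      rw [Ne, EmbeddingLike.map_eq_zero_iff]; exact hg0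
    have : e (e.symm (e g')⁻¹ * g') = e 1 := by
      rw [map_mul, e.apply_symm_apply, inv_mul_cancel₀ hg', map_one]
    have h4 := e.injective this
    have h5 : (g ≫ (e.symm (e g')⁻¹ : End (D.Δ i)) : D.Δ i ⟶ D.Δ i) = 𝟙 _ := h4
    have h6 : e (g' * e.symm (e g')⁻¹) = e 1 := by
      rw [map_mul, e.apply_symm_apply, mul_inv_cancel₀ hg', map_one]
    have h7 : ((e.symm (e g')⁻¹ : End (D.Δ i)) ≫ g : D.Δ i ⟶ D.Δ i) = 𝟙 _ := e.injective h6
    have hr0 : r = 0 := by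
      rw [← Category.id_comp r, ← h7, Category.assoc, hgr, comp_zero]
    rw [hr0, comp_zero] at hr
    exact id_nonzero (D.S i) (by rw [← cancel_epi (D.p i), ← hr]; simp)
  have : Mono (kernel.lift r f hfr) := by
    have : Mono (kernel.lift r f hfr ≫ kernel.ι r) := by simpa
    exact mono_of_mono _ (kernel.ι r)
  have := D.mult_le_of_mono (kernel.lift r f hfr) i
  omega

theorem DeligneData.mult_Δ_self (D : DeligneData k C n) (i : Fin n) : D.mult (D.Δ i) i ≠ 0 := by
  obtain ⟨r, hr⟩ := D.exists_top i
  have hp := (D.projCover i).2.1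
  have hre : Epi r := by
    have : Epi (D.q i ≫ r) := by rw [hr]; exact hp
    exact epi_of_epi (D.q i) r
  have := D.mult_le_of_epi r i
  rw [D.mult_simple, if_pos rfl] at this
  omega

/-! ### Phases -/

/-- cross product -/
def cross (z w : ℂ) : ℝ := z.re * w.im - z.im * w.re

theorem phase_lt_iff {z w : ℂ} (hz : z ∈ stabilityHalfPlane) (hw : w ∈ stabilityHalfPlane) :
    phase z < phase w ↔ 0 < cross z w := by
  have hz' : 0 < z.arg := hz
  have hw' : 0 < w.arg := hw
  have hz0 : z ≠ 0 := by rintro rfl; simp at hz'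
  have hw0 : w ≠ 0 := by rintro rfl; simp at hw'
  have h1 : cross z w = ‖z‖ * ‖w‖ * Real.sin (w.arg - z.arg) := by
    rw [Real.sin_sub, Complex.sin_arg, Complex.sin_arg, Complex.cos_arg hz0, Complex.cos_arg hw0,
      cross]
    have := norm_ne_zero_iff.2 hz0
    have := norm_ne_zero_iff.2 hw0
    field_simp
  have hpos : 0 < ‖z‖ * ‖w‖ := mul_pos (norm_pos_iff.2 hz0) (norm_pos_iff.2 hw0)
  have hz2 := Complex.arg_le_pi z
  have hw2 := Complex.arg_le_pi w
  rw [phase, phase, div_lt_div_iff_of_pos_right Real.pi_pos, h1]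
  constructor
  · intro h
    exact mul_pos hpos (Real.sin_pos_of_pos_of_lt_pi (by linarith) (by linarith))
  · intro h
    by_contra hc
    have := Real.sin_nonpos_of_nonpos_of_neg_pi_le (x := w.arg - z.arg) (by linarith) (by linarith)
    nlinarith

theorem phase_le_iff {z w : ℂ} (hz : z ∈ stabilityHalfPlane) (hw : w ∈ stabilityHalfPlane) :
    phase z ≤ phase w ↔ 0 ≤ cross z w := by
  rw [← not_lt, phase_lt_iff hw hz, not_lt]
  have : cross z w = - cross w z := by simp only [cross]; ring
  constructor <;> intro h <;> linarith

theorem K0.cls_ext (S : ShortComplex C) (hS : S.ShortExact) :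
    K0.cls S.X₂ = K0.cls S.X₁ + K0.cls S.X₃ := by
  have h : (QuotientAddGroup.mk (FreeAbelianGroup.of S.X₂ - FreeAbelianGroup.of S.X₁ -
      FreeAbelianGroup.of S.X₃) : FreeAbelianGroup C ⧸ K0Relations C) = 0 :=
    (QuotientAddGroup.eq_zero_iff _).2 (AddSubgroup.subset_closure ⟨S, hS, rfl⟩)
  have h2 : K0.cls S.X₂ - K0.cls S.X₁ - K0.cls S.X₃ = 0 := h
  rw [sub_sub, sub_eq_zero] at h2
  exact h2

theorem K0.cls_mono {X Y : C} (f : X ⟶ Y) [Mono f] :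
    K0.cls Y = K0.cls X + K0.cls (cokernel f) :=
  K0.cls_ext (ShortComplex.mk f (cokernel.π f) (by simp))
    { exact := ShortComplex.exact_cokernel f }

theorem K0.cls_epi {X Y : C} (f : X ⟶ Y) [Epi f] :
    K0.cls X = K0.cls (kernel f) + K0.cls Y :=
  K0.cls_ext (ShortComplex.mk (kernel.ι f) f (by simp))
    { exact := ShortComplex.exact_kernel f }

theorem K0.cls_isZero {X : C} (h : IsZero X) : K0.cls X = 0 := by
  have := K0.cls_ext (ShortComplex.mk (𝟙 X) (0 : X ⟶ X) (by simp))
    { exact := by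
        rw [ShortComplex.exact_iff_epi _ rfl]; dsimp; infer_instance
      epi_g := ⟨fun _ _ _ => h.eq_of_src _ _⟩ }
  simpa using this

theorem K0.cls_iso {X Y : C} (e : X ≅ Y) : K0.cls X = K0.cls Y := by
  rw [K0.cls_mono e.hom, K0.cls_isZero (isZero_cokernel_of_epi e.hom), add_zero]

/-! ### The reverse direction -/

theorem stable_isIso (D : DeligneData k C n) (Z : K0 C →+ ℂ) (hZ : IsStabilityFunction Z) {X : C}
    (hX : IsZStable Z X) (f : X ⟶ X) (hf : f ≠ 0) : IsIso f := by
  by_contra hni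
  have hK : ¬ IsZero (kernel f) := by
    intro h
    have : Mono f := Preadditive.mono_of_isZero_kernel f h
    exact hni (D.isIso_of_len f le_rfl)
  have hI : ¬ IsZero (Abelian.image f) := by
    intro h
    apply hf
    rw [← Abelian.image.fac f, h.eq_zero_of_src (Abelian.image.ι f), comp_zero]
  have hI2 : ¬ IsIso (Abelian.image.ι f) := by
    intro h
    apply hni
    have h1 : Epi f := by
      rw [← Abelian.image.fac f]; exact epi_comp _ _
    have h2 := D.len_epi f
    exact absurd (D.len_eq_zero.1 (by omega)) hK
  have hK2 : ¬ IsIso (kernel.ι f) := by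
    intro h
    exact hf (by rw [← cancel_epi (kernel.ι f), kernel.condition, comp_zero])
  have h1 := hX.2 (kernel.ι f) inferInstance hK hK2
  have h2 := hX.2 (Abelian.image.ι f) inferInstance hI hI2
  rw [phase_lt_iff (hZ _ hK) (hZ _ hX.1)] at h1
  rw [phase_lt_iff (hZ _ hI) (hZ _ hX.1)] at h2
  have h3 : K0.cls X = K0.cls (kernel f) + K0.cls (Abelian.image f) := by
    have h4 := K0.cls_epi (Abelian.factorThruImage f)
    rw [h4]
    congr 1
    apply K0.cls_iso
    refine (kernelCompMono (Abelian.factorThruImage f) (Abelian.image.ι f)).symm ≪≫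
      kernelIsoOfEq (Abelian.image.fac f)
  rw [h3, map_add] at h1 h2
  simp only [cross, Complex.add_re, Complex.add_im] at h1 h2
  nlinarith

theorem end_equiv (D : DeligneData k C n) {X : C} (hX : ¬ IsZero X)
    (h : ∀ f : X ⟶ X, f ≠ 0 → IsIso f) : Nonempty (End X ≃ₐ[k] k) := by
  have hid : 𝟙 X ≠ 0 := fun h0 => hX ((IsZero.iff_id_eq_zero X).2 h0)
  have := D.homFinite X X
  have hr : Module.finrank k (X ⟶ X) = 1 := by
    refine finrank_endomorphism_eq_one k (fun f => ⟨?_, h f⟩)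
    rintro hi rfl
    exact hid (by rw [← cancel_epi (0 : X ⟶ X)]; simp)
  have hr' : Module.finrank k (End X) = 1 := hr
  have hnt : Nontrivial (End X) := nontrivial_of_ne (𝟙 X) 0 hid
  have hb := Subalgebra.bot_eq_top_iff_finrank_eq_one.2 hr'
  exact ⟨(Subalgebra.topEquiv.symm.trans (Subalgebra.equivOfEq _ _ hb.symm)).trans
    (Algebra.botEquivOfInjective (algebraMap k (End X)).injective)⟩

/-- Sum decomposition of a finite biproduct. -/
theorem biproduct_succ {m : ℕ} (g : Fin (m + 1) → C) :
    Nonempty ((⨁ g) ≅ (g 0) ⊞ (⨁ fun a : Fin m => g a.succ)) := by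
  refine ⟨⟨biprod.lift (biproduct.π g 0) (biproduct.lift fun a => biproduct.π g a.succ),
    biprod.desc (biproduct.ι g 0) (biproduct.desc fun a => biproduct.ι g a.succ), ?_, ?_⟩⟩
  · rw [biprod.lift_desc, biproduct.lift_desc, ← biproduct.total, Fin.sum_univ_succ]
  · apply biprod.hom_ext' <;> apply biprod.hom_ext
    · simp
    · ext a
      simp [biproduct.ι_π]
      intro h
      exact absurd h.symm (Fin.succ_ne_zero a)
    · ext a
      simp
    · ext a b
      simp [biproduct.ι_π]

theorem ExtClosure.biprod {Q : C → Prop} {X Y : C} (hX : ExtClosure Q X) (hY : ExtClosure Q Y) :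
    ExtClosure Q (X ⊞ Y) :=
  .ext (ShortComplex.mk (biprod.inl : X ⟶ X ⊞ Y) biprod.snd (by simp))
    (ShortComplex.Splitting.ofHasBinaryBiproduct X Y).shortExact hX hY

theorem ExtClosure.biproduct {Q : C → Prop} {m : ℕ} (g : Fin m → C)
    (h : ∀ a, ExtClosure Q (g a)) : ExtClosure Q (⨁ g) := by
  induction m with
  | zero =>
    apply ExtClosure.zero
    rw [IsZero.iff_id_eq_zero]
    apply biproduct.hom_ext'
    intro j; exact j.elim0
  | succ m ih =>
    obtain ⟨e⟩ := biproduct_succ g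
    exact ExtClosure.iso e.symm (ExtClosure.biprod (h 0) (ih _ (fun a => h a.succ)))

theorem reverse_direction (D : DeligneData k C n) (Z : K0 C →+ ℂ) (hZ : IsStabilityFunction Z)
    (hst : ∀ i, IsZStable Z (D.Δ i))
    (hhn : ∀ i, ∃ hn : HNFiltration Z (D.P i), ∀ l : Fin hn.d,
          ∃ (N : ℕ) (g : Fin N → Fin n), (∀ a, i ≤ g a) ∧
            Nonempty (cokernel (hn.f l) ≅ ⨁ (fun a : Fin N => D.Δ (g a)))) :
    D.IsHighestWeight := by
  intro i
  refine ⟨end_equiv D (hst i).1 (stable_isIso D Z hZ (hst i)), ?_⟩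
  obtain ⟨hn, h⟩ := hhn i
  obtain ⟨e⟩ := hn.top_iso
  apply ExtClosure.iso e
  have key : ∀ l : Fin (hn.d + 1),
      ExtClosure (fun X => ∃ j, i ≤ j ∧ Nonempty (X ≅ D.Δ j)) (hn.F l) := by
    intro l
    induction l using Fin.induction with
    | zero => exact .zero _ hn.isZero_bot
    | succ l ih =>
      have := hn.mono l
      refine .ext (ShortComplex.mk (hn.f l) (cokernel.π (hn.f l)) (by simp))
        { exact := ShortComplex.exact_cokernel _ } ih ?_
      obtain ⟨N, g, hg, ⟨e'⟩⟩ := h l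
      exact ExtClosure.iso e'.symm (ExtClosure.biproduct _ (fun a => .of _ ⟨g a, hg a, ⟨Iso.refl _⟩⟩))
  exact key _

/-! ### The forward direction: reordering of the filtration -/

theorem ExtClosure.mult_eq_zero (D : DeligneData k C n) {Q : C → Prop} (j : Fin n)
    (hQ : ∀ X, Q X → D.mult X j = 0) {X : C} (h : ExtClosure Q X) : D.mult X j = 0 := by
  induction h with
  | of X h => exact hQ X h
  | zero X h => exact D.mult_isZero h j
  | ext S hS _ _ h1 h2 => rw [D.mult_additive S hS, h1, h2]

/-- finite direct sums of copies of an object -/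
def IsCopies (X Q : C) : Prop := ∃ m : ℕ, Nonempty (Q ≅ ⨁ (fun _ : Fin m => X))

theorem isZero_biproduct_zero (g : Fin 0 → C) : IsZero (⨁ g) := by
  rw [IsZero.iff_id_eq_zero]
  apply biproduct.hom_ext'
  intro j; exact j.elim0

theorem IsCopies.of_isZero {X Q : C} (h : IsZero Q) : IsCopies X Q :=
  ⟨0, ⟨h.iso (isZero_biproduct_zero _)⟩⟩

theorem IsCopies.biprod {X Q R : C} (hQ : IsCopies X Q) (hR : IsCopies X R) :
    IsCopies X (Q ⊞ R) := by
  obtain ⟨a, ⟨e⟩⟩ := hQ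
  obtain ⟨c, ⟨e'⟩⟩ := hR
  induction a generalizing Q with
  | zero =>
    exact ⟨c, ⟨(isoZeroBiprod ((isZero_biproduct_zero _).of_iso e)).symm ≪≫ e'⟩⟩
  | succ a ih =>
    obtain ⟨m, ⟨e₁⟩⟩ := ih (Q := ⨁ (fun _ : Fin a => X)) (Iso.refl _)
    obtain ⟨e₂⟩ := biproduct_succ (fun _ : Fin (a + 1) => X)
    obtain ⟨e₃⟩ := biproduct_succ (fun _ : Fin (m + 1) => X)
    exact ⟨m + 1, ⟨biprod.mapIso (e ≪≫ e₂) (Iso.refl R) ≪≫ biprod.associator _ _ _ ≪≫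
      biprod.mapIso (Iso.refl X) e₁ ≪≫ e₃.symm⟩⟩

theorem IsCopies.of_iso {X Q : C} (e : Q ≅ X) : IsCopies X Q := by
  obtain ⟨e₃⟩ := biproduct_succ (fun _ : Fin (0 + 1) => X)
  exact ⟨0 + 1, ⟨e ≪≫ isoBiprodZero (isZero_biproduct_zero _) ≪≫ e₃.symm⟩⟩

theorem IsCopies.extClosure {X Q : C} (h : IsCopies X Q) :
    ExtClosure (fun Y => Nonempty (Y ≅ X)) Q := by
  obtain ⟨m, ⟨e⟩⟩ := h
  exact ExtClosure.iso e.symm (ExtClosure.biproduct _ (fun _ => .of _ ⟨Iso.refl _⟩))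

theorem DeligneData.hom_kernel (D : DeligneData k C n) (i : Fin n) {Y : C}
    (hY : ∀ j, i < j → D.mult Y j = 0) (f : kernel (D.q i) ⟶ Y) : f = 0 := by
  have hq := (D.std i).1
  let u : kernel f ⟶ D.P i := kernel.ι f ≫ kernel.ι (D.q i)
  have hu : Mono u := mono_comp _ _
  obtain ⟨r, hr⟩ := (D.std i).2.2 (cokernel.π u) inferInstance
    ((D.serre_iff i _).2 (fun j hj => by
      have h1 := D.mult_epi (D.q i) j
      have h2 := D.mult_mono u j
      have h3 := D.mult_mono (kernel.ι f) j
      have h4 : D.mult (Abelian.coimage f) j ≤ D.mult Y j :=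
        D.mult_le_of_mono (Abelian.factorThruCoimage f) j
      have h5 : D.mult (Abelian.coimage f) j = D.mult (cokernel (kernel.ι f)) j := rfl
      rw [D.mult_Δ hj] at h1
      rw [hY j hj] at h4
      omega))
  have h0 : kernel.ι (D.q i) ≫ cokernel.π u = 0 := by
    rw [← hr, ← Category.assoc, kernel.condition, zero_comp]
  have h1 := Abelian.monoLift_comp u (kernel.ι (D.q i)) h0
  have h2 : Abelian.monoLift u (kernel.ι (D.q i)) h0 ≫ kernel.ι f = 𝟙 _ := by
    rw [← cancel_mono (kernel.ι (D.q i)), Category.assoc, h1, Category.id_comp]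
  rw [← Category.id_comp f, ← h2, Category.assoc, kernel.condition, comp_zero]

theorem DeligneData.ext_vanish [HasExt.{v} C] (D : DeligneData k C n) (i : Fin n) {Y : C}
    (hY : ∀ j, i < j → D.mult Y j = 0) (x : Abelian.Ext.{v} (D.Δ i) Y 1) : x = 0 := by
  have hq := (D.std i).1
  have hP := (D.projCover i).1
  have hS : (ShortComplex.mk (kernel.ι (D.q i)) (D.q i) (by simp)).ShortExact :=
    { exact := ShortComplex.exact_kernel _ }
  obtain ⟨y, hy⟩ := Abelian.Ext.contravariant_sequence_exact₃ hS Y x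
    (Abelian.Ext.eq_zero_of_projective _) (n₀ := 0) rfl
  obtain ⟨f, rfl⟩ := (Abelian.Ext.mk₀_bijective _ _).2 y
  rw [← hy, D.hom_kernel i hY f]
  simp

theorem DeligneData.ext_vanish_filt [HasExt.{v} C] (D : DeligneData k C n) (s : Fin n) {Y : C}
    (hY : ∀ j, s < j → D.mult Y j = 0) {X : C}
    (hX : ExtClosure (fun X => ∃ j, s ≤ j ∧ Nonempty (X ≅ D.Δ j)) X)
    (x : Abelian.Ext.{v} X Y 1) : x = 0 := by
  induction hX with
  | of X h =>
    obtain ⟨j, hj, ⟨e⟩⟩ := h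
    have h1 : (Abelian.Ext.mk₀ e.inv).comp x (zero_add 1) = 0 :=
      D.ext_vanish j (fun l hl => hY l (lt_of_le_of_lt hj hl)) _
    have h2 : (Abelian.Ext.mk₀ e.hom).comp ((Abelian.Ext.mk₀ e.inv).comp x (zero_add 1))
        (zero_add 1) = x := by
      rw [Abelian.Ext.mk₀_comp_mk₀_assoc]; simp
    rw [← h2, h1]; simp
  | zero X h =>
    have : Projective X := ⟨fun f e _ => ⟨0, h.eq_of_src _ _⟩⟩
    exact Abelian.Ext.eq_zero_of_projective _
  | ext S hS _ _ h1 h2 =>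
    obtain ⟨y, hy⟩ := Abelian.Ext.contravariant_sequence_exact₂ hS Y x (h1 _)
    rw [← hy, h2 y]; simp

theorem DeligneData.extend (D : DeligneData k C n) (s : Fin n) {Y : C}
    (hY : ∀ j, s < j → D.mult Y j = 0) (S : ShortComplex C) (hS : S.ShortExact)
    (hX : ExtClosure (fun X => ∃ j, s ≤ j ∧ Nonempty (X ≅ D.Δ j)) S.X₃)
    (g : S.X₁ ⟶ Y) : ∃ b : S.X₂ ⟶ Y, S.f ≫ b = g := by
  have : HasExt.{v} C := hasExt_of_enoughProjectives.{v} C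
  obtain ⟨y, hy⟩ := Abelian.Ext.contravariant_sequence_exact₁ hS Y (Abelian.Ext.mk₀ g)
    (n₁ := 1) rfl (D.ext_vanish_filt s hY hX _)
  obtain ⟨b, rfl⟩ := (Abelian.Ext.mk₀_bijective _ _).2 y
  refine ⟨b, (Abelian.Ext.mk₀_bijective _ _).1 ?_⟩
  rw [← hy, Abelian.Ext.mk₀_comp_mk₀]

/-- Kernels of a morphism of short exact sequences with epimorphic ends. -/
theorem snake_epi {S T : ShortComplex C} (φ : S ⟶ T) (hS : S.ShortExact) (hT : T.ShortExact)
    (h1 : Epi φ.τ₁) (h3 : Epi φ.τ₃) (Q : C → Prop) (hQ1 : ExtClosure Q (kernel φ.τ₁))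
    (hQ3 : ExtClosure Q (kernel φ.τ₃)) : Epi φ.τ₂ ∧ ExtClosure Q (kernel φ.τ₂) := by
  let N : ShortComplex.SnakeInput C :=
    { L₀ := kernel φ
      L₁ := S
      L₂ := T
      L₃ := cokernel φ
      v₀₁ := kernel.ι φ
      v₁₂ := φ
      v₂₃ := cokernel.π φ
      w₀₂ := kernel.condition φ
      w₁₃ := cokernel.condition φ
      h₀ := kernelIsKernel φ
      h₃ := cokernelIsCokernel φ
      L₁_exact := hS.exact
      epi_L₁_g := hS.epi_g
      L₂_exact := hT.exact
      mono_L₂_f := hT.mono_f }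
  have e1 : N.L₀.X₁ ≅ kernel φ.τ₁ := IsLimit.conePointUniqueUpToIso N.h₀τ₁ (limit.isLimit _)
  have e2 : N.L₀.X₂ ≅ kernel φ.τ₂ := IsLimit.conePointUniqueUpToIso N.h₀τ₂ (limit.isLimit _)
  have e3 : N.L₀.X₃ ≅ kernel φ.τ₃ := IsLimit.conePointUniqueUpToIso N.h₀τ₃ (limit.isLimit _)
  have c1 : N.L₃.X₁ ≅ cokernel φ.τ₁ :=
    IsColimit.coconePointUniqueUpToIso N.h₃τ₁ (colimit.isColimit _)
  have c2 : N.L₃.X₂ ≅ cokernel φ.τ₂ :=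
    IsColimit.coconePointUniqueUpToIso N.h₃τ₂ (colimit.isColimit _)
  have c3 : N.L₃.X₃ ≅ cokernel φ.τ₃ :=
    IsColimit.coconePointUniqueUpToIso N.h₃τ₃ (colimit.isColimit _)
  have z1 : IsZero N.L₃.X₁ := (isZero_cokernel_of_epi φ.τ₁).of_iso c1
  have z3 : IsZero N.L₃.X₃ := (isZero_cokernel_of_epi φ.τ₃).of_iso c3
  have z2 : IsZero N.L₃.X₂ :=
    N.L₃_exact.isZero_of_both_zeros (z1.eq_of_src _ _) (z3.eq_of_tgt _ _)
  refine ⟨Preadditive.epi_of_isZero_cokernel _ (z2.of_iso c2.symm), ?_⟩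
  have hm : Mono N.L₁.f := hS.mono_f
  have hm0 : Mono N.L₀.f := N.mono_L₀_f
  have he0 : Epi N.L₀.g := N.L₁'_exact.epi_f (z1.eq_of_tgt _ _)
  exact ExtClosure.iso e2 (.ext N.L₀ { exact := N.L₀_exact } (ExtClosure.iso e1.symm hQ1)
    (ExtClosure.iso e3.symm hQ3))

theorem DeligneData.peel (D : DeligneData k C n) (s : Fin n) {X : C}
    (hX : ExtClosure (fun X => ∃ j, s ≤ j ∧ Nonempty (X ≅ D.Δ j)) X) :
    ∃ (Q : C) (g : X ⟶ Q), Epi g ∧ IsCopies (D.Δ s) Q ∧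
      ExtClosure (fun X => ∃ j, s < j ∧ Nonempty (X ≅ D.Δ j)) (kernel g) := by
  induction hX with
  | of X h =>
    obtain ⟨j, hj, ⟨e⟩⟩ := h
    rcases hj.lt_or_eq with hj | rfl
    · refine ⟨⨁ (fun _ : Fin 0 => D.Δ s), 0, ?_, .of_isZero (isZero_biproduct_zero _), ?_⟩
      · exact ⟨fun _ _ _ => (isZero_biproduct_zero _).eq_of_src _ _⟩
      · exact .of _ ⟨j, hj, ⟨kernelZeroIsoSource ≪≫ e⟩⟩
    · exact ⟨X, 𝟙 X, inferInstance, .of_iso e, .zero _ (isZero_kernel_of_mono _)⟩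
  | zero X h =>
    exact ⟨X, 𝟙 X, inferInstance, .of_isZero h, .zero _ (isZero_kernel_of_mono _)⟩
  | ext S hS hS1 hS3 h1 h3 =>
    obtain ⟨Q, a, ha, hQ, ha'⟩ := h1
    obtain ⟨R, c, hc, hR, hc'⟩ := h3
    obtain ⟨b, hb⟩ := D.extend s (fun j hj => ExtClosure.mult_eq_zero D j
      (by rintro X ⟨e⟩; rw [D.mult_iso e, D.mult_Δ hj]) hQ.extClosure) S hS hS3 a
    let φ : S ⟶ ShortComplex.mk (biprod.inl : Q ⟶ Q ⊞ R) biprod.snd (by simp) :=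
      { τ₁ := a
        τ₂ := biprod.lift b (S.g ≫ c)
        τ₃ := c
        comm₁₂ := by
          apply biprod.hom_ext
          · simp [hb]
          · simp
        comm₂₃ := by simp }
    obtain ⟨k1, k2⟩ := snake_epi φ hS (ShortComplex.Splitting.ofHasBinaryBiproduct Q R).shortExact
      ha hc _ ha' hc'
    exact ⟨Q ⊞ R, φ.τ₂, k1, hQ.biprod hR, k2⟩

/-! ### The forward direction: the stability function -/

/-- weights of the simple objects -/
noncomputable def wt (B : ℕ) (j : ℕ) : ℂ := ⟨-((B : ℝ) ^ j), 1⟩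

/-- the stability function -/
noncomputable def DeligneData.stab (D : DeligneData k C n) (B : ℕ) : K0 C →+ ℂ :=
  QuotientAddGroup.lift (K0Relations C)
    (FreeAbelianGroup.lift (fun X => ∑ j, (D.mult X j : ℂ) * wt B j)) (by
      rw [K0Relations, AddSubgroup.closure_le]
      rintro x ⟨S, hS, rfl⟩
      simp only [SetLike.mem_coe, AddMonoidHom.mem_ker, map_sub, FreeAbelianGroup.lift_apply_of,
        D.mult_additive S hS, Nat.cast_add, add_mul, Finset.sum_add_distrib]
      ring)

theorem DeligneData.stab_cls (D : DeligneData k C n) (B : ℕ) (X : C) :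
    D.stab B (K0.cls X) = ∑ j, (D.mult X j : ℂ) * wt B j := by
  change FreeAbelianGroup.lift _ (FreeAbelianGroup.of X) = _
  rw [FreeAbelianGroup.lift_apply_of]

theorem DeligneData.stab_im (D : DeligneData k C n) (B : ℕ) (X : C) :
    (D.stab B (K0.cls X)).im = (D.len X : ℝ) := by
  rw [D.stab_cls, Complex.im_sum, DeligneData.len, Nat.cast_sum]
  refine Finset.sum_congr rfl (fun j _ => ?_)
  simp [wt]

theorem DeligneData.stab_re (D : DeligneData k C n) (B : ℕ) (X : C) :
    (D.stab B (K0.cls X)).re = -((∑ j, D.mult X j * B ^ (j : ℕ) : ℕ) : ℝ) := by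
  rw [D.stab_cls, Complex.re_sum, Nat.cast_sum, ← Finset.sum_neg_distrib]
  refine Finset.sum_congr rfl (fun j _ => ?_)
  simp [wt]

theorem DeligneData.stab_isStab (D : DeligneData k C n) (B : ℕ) :
    IsStabilityFunction (D.stab B) := by
  intro X hX
  have h : 0 < (D.stab B (K0.cls X)).im := by
    rw [D.stab_im]
    have : D.len X ≠ 0 := fun h => hX (D.len_eq_zero.1 h)
    exact_mod_cast Nat.pos_of_ne_zero this
  have h1 : 0 ≤ (D.stab B (K0.cls X)).arg := Complex.arg_nonneg_iff.2 h.le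
  rcases h1.lt_or_eq with h2 | h2
  · exact h2
  · have := Complex.arg_eq_zero_iff.1 h2.symm
    exact absurd this.2 h.ne'

theorem DeligneData.stab_lt (D : DeligneData k C n) (B : ℕ) (i : Fin n)
    (hB : D.len (D.Δ i) < B) {Y : C} (hY : ¬ IsZero Y)
    (h : ∀ j, i ≤ j → D.mult Y j = 0) :
    phase (D.stab B (K0.cls Y)) < phase (D.stab B (K0.cls (D.Δ i))) := by
  rw [phase_lt_iff (D.stab_isStab B _ hY) (D.stab_isStab B _ (D.not_isZero_Δ i)), cross,
    D.stab_im, D.stab_im, D.stab_re, D.stab_re]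
  have h0 : D.len Y ≠ 0 := fun h => hY (D.len_eq_zero.1 h)
  have h1 : B ^ (i : ℕ) ≤ ∑ j, D.mult (D.Δ i) j * B ^ (j : ℕ) := by
    refine le_trans ?_ (Finset.single_le_sum (f := fun j : Fin n => D.mult (D.Δ i) j * B ^ (j : ℕ))
      (fun _ _ => Nat.zero_le _) (Finset.mem_univ i))
    exact Nat.le_mul_of_pos_left _ (Nat.pos_of_ne_zero (D.mult_Δ_self i))
  have h2 : (∑ j, D.mult Y j * B ^ (j : ℕ)) * D.len (D.Δ i) + D.len Y
      ≤ D.len Y * B ^ (i : ℕ) := by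
    rw [DeligneData.len, DeligneData.len, Finset.sum_mul, Finset.sum_mul,
      ← Finset.sum_add_distrib]
    refine Finset.sum_le_sum (fun j _ => ?_)
    rcases le_or_gt i j with hj | hj
    · rw [h j hj]; simp
    · have h3 : B ^ (j : ℕ) * D.len (D.Δ i) + 1 ≤ B ^ (i : ℕ) := by
        have hBp : 0 < B := by omega
        have h4 : B ^ ((j : ℕ) + 1) ≤ B ^ (i : ℕ) := Nat.pow_le_pow_right hBp hj
        have h5 : B ^ (j : ℕ) * (D.len (D.Δ i) + 1) ≤ B ^ (j : ℕ) * B :=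
          Nat.mul_le_mul_left _ hB
        have h6 : 0 < B ^ (j : ℕ) := Nat.pow_pos hBp
        rw [pow_succ] at h4
        rw [mul_add, mul_one] at h5
        omega
      have h4 := Nat.mul_le_mul_left (D.mult Y j) h3
      rw [DeligneData.len] at h4
      rw [mul_add, mul_one, ← mul_assoc] at h4
      exact h4
  have h3 : D.len Y * B ^ (i : ℕ) ≤ D.len Y * ∑ j, D.mult (D.Δ i) j * B ^ (j : ℕ) :=
    Nat.mul_le_mul_left _ h1
  have h4 : (∑ j, D.mult Y j * B ^ (j : ℕ)) * D.len (D.Δ i)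
      < D.len Y * ∑ j, D.mult (D.Δ i) j * B ^ (j : ℕ) := by omega
  have h5 : (((∑ j, D.mult Y j * B ^ (j : ℕ) : ℕ) : ℝ)) * (D.len (D.Δ i) : ℝ)
      < (D.len Y : ℝ) * ((∑ j, D.mult (D.Δ i) j * B ^ (j : ℕ) : ℕ) : ℝ) := by exact_mod_cast h4
  linarith

/-! ### Semistability of direct sums -/

theorem cross_add_left (a b c : ℂ) : cross (a + b) c = cross a c + cross b c := by
  simp only [cross, Complex.add_re, Complex.add_im]; ring

theorem copies_cross (Z : K0 C →+ ℂ) (hZ : IsStabilityFunction Z) {T : C} (hT : IsZStable Z T)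
    {X : C} (hX : ExtClosure (fun Y => Nonempty (Y ≅ T)) X) :
    cross (Z (K0.cls X)) (Z (K0.cls T)) = 0 ∧
      ∀ (Y : C) (f : Y ⟶ X), Mono f → 0 ≤ cross (Z (K0.cls Y)) (Z (K0.cls T)) := by
  have hzero : ∀ Y : C, IsZero Y → cross (Z (K0.cls Y)) (Z (K0.cls T)) = 0 := by
    intro Y hY
    rw [K0.cls_isZero hY, map_zero]; simp [cross]
  have hself : cross (Z (K0.cls T)) (Z (K0.cls T)) = 0 := by simp only [cross]; ring
  induction hX with
  | of X h =>
    obtain ⟨e⟩ := h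
    refine ⟨by rw [K0.cls_iso e, hself], fun Y f hf => ?_⟩
    by_cases hY : IsZero Y
    · rw [hzero Y hY]
    by_cases hi : IsIso f
    · rw [K0.cls_iso (asIso f ≪≫ e), hself]
    · have hni : ¬ IsIso (f ≫ e.hom) := fun h => hi (IsIso.of_isIso_comp_right f e.hom)
      have := hT.2 (f ≫ e.hom) (mono_comp _ _) hY hni
      rw [phase_lt_iff (hZ _ hY) (hZ _ hT.1)] at this
      exact this.le
  | zero X h =>
    refine ⟨hzero X h, fun Y f hf => ?_⟩
    rw [hzero Y (IsZero.of_mono f h)]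
  | ext S hS _ _ h1 h3 =>
    refine ⟨by rw [K0.cls_ext S hS, map_add, cross_add_left, h1.1, h3.1, add_zero],
      fun Y f hf => ?_⟩
    have hmf := hS.mono_f
    let u : kernel (f ≫ S.g) ⟶ S.X₁ := hS.exact.lift (kernel.ι (f ≫ S.g) ≫ f) (by simp)
    have hu : u ≫ S.f = kernel.ι (f ≫ S.g) ≫ f := hS.exact.lift_f _ _
    have hum : Mono u := by
      have : Mono (u ≫ S.f) := by rw [hu]; exact mono_comp _ _
      exact mono_of_mono u S.f
    have k1 := h1.2 _ u hum
    have k3 := h3.2 _ (Abelian.factorThruCoimage (f ≫ S.g)) inferInstance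
    have : K0.cls Y = K0.cls (kernel (f ≫ S.g)) + K0.cls (Abelian.coimage (f ≫ S.g)) :=
      K0.cls_mono (kernel.ι (f ≫ S.g))
    rw [this, map_add, cross_add_left]
    exact add_nonneg k1 k3

theorem copies_phase (Z : K0 C →+ ℂ) (hZ : IsStabilityFunction Z) {T : C} (hT : IsZStable Z T)
    {X : C} (hX : IsCopies T X) (h0 : ¬ IsZero X) :
    phase (Z (K0.cls X)) = phase (Z (K0.cls T)) := by
  have h := (copies_cross Z hZ hT hX.extClosure).1
  apply le_antisymm
  · rw [phase_le_iff (hZ _ h0) (hZ _ hT.1), h]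
  · rw [phase_le_iff (hZ _ hT.1) (hZ _ h0)]
    have : cross (Z (K0.cls T)) (Z (K0.cls X)) = - cross (Z (K0.cls X)) (Z (K0.cls T)) := by
      simp only [cross]; ring
    rw [this, h, neg_zero]

theorem copies_semistable (Z : K0 C →+ ℂ) (hZ : IsStabilityFunction Z) {T : C}
    (hT : IsZStable Z T) {X : C} (hX : IsCopies T X) (h0 : ¬ IsZero X) : IsZSemistable Z X := by
  refine ⟨h0, fun Y f hf hY _ => ?_⟩
  rw [copies_phase Z hZ hT hX h0, phase_le_iff (hZ _ hY) (hZ _ hT.1)]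
  exact (copies_cross Z hZ hT hX.extClosure).2 Y f hf

/-! ### Harder-Narasimhan filtrations -/

theorem exists_snoc {d : ℕ} (F : Fin (d + 1) → C) (f : ∀ l : Fin d, F l.castSucc ⟶ F l.succ)
    {X : C} (g : F (Fin.last d) ⟶ X) :
    ∃ (F' : Fin (d + 1 + 1) → C) (f' : ∀ l : Fin (d + 1), F' l.castSucc ⟶ F' l.succ),
      F' 0 = F 0 ∧ F' (Fin.last (d + 1)) = X ∧
      (∀ l : Fin d, Nonempty (Arrow.mk (f' l.castSucc) ≅ Arrow.mk (f l))) ∧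
      Nonempty (Arrow.mk (f' (Fin.last d)) ≅ Arrow.mk g) := by
  let F' : Fin (d + 1 + 1) → C := Fin.snoc (α := fun _ => C) F X
  have hc : ∀ l : Fin (d + 1), F' l.castSucc = F l := fun l =>
    Fin.snoc_castSucc (α := fun _ => C) X F l
  have hl : F' (Fin.last (d + 1)) = X := Fin.snoc_last (α := fun _ => C) X F
  have hs : ∀ l : Fin d, F' l.castSucc.succ = F l.succ := fun l => by
    rw [Fin.succ_castSucc, hc]
  let f' : ∀ l : Fin (d + 1), F' l.castSucc ⟶ F' l.succ :=
    Fin.lastCases (motive := fun l => F' l.castSucc ⟶ F' l.succ)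
      (eqToHom (hc _) ≫ g ≫ eqToHom hl.symm)
      (fun l => eqToHom (hc _) ≫ f l ≫ eqToHom (hs l).symm)
  refine ⟨F', f', hc 0, hl, fun l => ⟨?_⟩, ⟨?_⟩⟩
  · refine Arrow.isoMk (eqToIso (hc _)) (eqToIso (hs l)) ?_
    simp [f']
  · refine Arrow.isoMk (eqToIso (hc _)) (eqToIso hl) ?_
    simp only [f', Fin.lastCases_last]
    simp

theorem arrow_mono {A B A' B' : C} {f : A ⟶ B} {g : A' ⟶ B'} (e : Arrow.mk f ≅ Arrow.mk g)
    (hg : Mono g) : Mono f := by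
  have : f = e.hom.left ≫ g ≫ e.inv.right := by
    have := Arrow.w e.hom
    have h2 : e.hom.right ≫ e.inv.right = 𝟙 _ := by simp
    dsimp at this h2
    rw [← Category.assoc, this, Category.assoc, h2, Category.comp_id]
  rw [this]
  exact mono_comp _ _

theorem arrow_cokernel {A B A' B' : C} {f : A ⟶ B} {g : A' ⟶ B'} (e : Arrow.mk f ≅ Arrow.mk g) :
    Nonempty (cokernel f ≅ cokernel g) :=
  ⟨cokernel.mapIso f g (Arrow.leftFunc.mapIso e) (Arrow.rightFunc.mapIso e) (Arrow.w e.hom).symm⟩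

theorem IsCopies.congr {X Q R : C} (h : IsCopies X Q) (e : R ≅ Q) : IsCopies X R := by
  obtain ⟨m, ⟨e'⟩⟩ := h
  exact ⟨m, ⟨e ≪≫ e'⟩⟩

theorem DeligneData.exists_hn (D : DeligneData k C n) (Z : K0 C →+ ℂ) (hZ : IsStabilityFunction Z)
    (hst : ∀ i, IsZStable Z (D.Δ i))
    (hlt : ∀ i j : Fin n, i < j → phase (Z (K0.cls (D.Δ i))) < phase (Z (K0.cls (D.Δ j))))
    (m t : ℕ) (hmt : n ≤ t + m) (X : C)
    (hX : ExtClosure (fun X => ∃ j : Fin n, t ≤ (j : ℕ) ∧ Nonempty (X ≅ D.Δ j)) X) :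
    ∃ hn : HNFiltration Z X, ∀ l : Fin hn.d, ∃ j : Fin n, t ≤ (j : ℕ) ∧
      IsCopies (D.Δ j) (cokernel (hn.f l)) := by
  induction m generalizing t X with
  | zero =>
    have hX0 : IsZero X := by
      induction hX with
      | of X h => obtain ⟨j, hj, _⟩ := h; omega
      | zero X h => exact h
      | ext S hS _ _ h1 h2 =>
        exact hS.exact.isZero_of_both_zeros (h1.eq_of_src _ _) (h2.eq_of_tgt _ _)
    exact ⟨{ d := 0
             F := fun _ => X
             isZero_bot := hX0
             top_iso := ⟨Iso.refl _⟩
             f := fun l => l.elim0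
             mono := fun l => l.elim0
             semistable := fun l => l.elim0
             phases_strictAnti := fun l => l.elim0 }, fun l => l.elim0⟩
  | succ m ih =>
    by_cases htn : n ≤ t
    · obtain ⟨hn, h⟩ := ih t (by omega) X hX
      exact ⟨hn, h⟩
    let s : Fin n := ⟨t, by omega⟩
    obtain ⟨Q, g, hg, hQ, hK⟩ := D.peel s (X := X) hX
    obtain ⟨hn, h⟩ := ih (t + 1) (by omega) (kernel g) hK
    obtain ⟨e⟩ := hn.top_iso
    by_cases hQ0 : IsZero Q
    · have hg0 : g = 0 := hQ0.eq_of_tgt _ _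
      have : IsIso (kernel.ι g) := by rw [hg0]; infer_instance
      refine ⟨{ hn with top_iso := ⟨e ≪≫ asIso (kernel.ι g)⟩ }, fun l => ?_⟩
      obtain ⟨j, hj, hc⟩ := h l
      exact ⟨j, by omega, hc⟩
    obtain ⟨F', f', h0, hl, hcs, ⟨ela⟩⟩ := exists_snoc hn.F hn.f (e.hom ≫ kernel.ι g)
    -- cokernels
    have hcok : ∀ l, IsCopies (D.Δ s) (cokernel (f' l)) ∧ l = Fin.last hn.d ∨
        ∃ j, s < j ∧ IsCopies (D.Δ j) (cokernel (f' l)) ∧ ∃ l' : Fin hn.d, l = l'.castSucc := by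
      intro l
      induction l using Fin.lastCases with
      | last =>
        left
        refine ⟨?_, rfl⟩
        obtain ⟨e₁⟩ := arrow_cokernel ela
        have e₂ : cokernel (e.hom ≫ kernel.ι g) ≅ cokernel (kernel.ι g) :=
          cokernelEpiComp e.hom (kernel.ι g)
        have e₃ : cokernel (kernel.ι g) ≅ Q :=
          IsColimit.coconePointUniqueUpToIso (colimit.isColimit _)
            (Abelian.epiIsCokernelOfKernel _ (kernelIsKernel g))
        exact hQ.congr (e₁ ≪≫ e₂ ≪≫ e₃)
      | cast l =>
        right
        obtain ⟨j, hj, hc⟩ := h l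
        obtain ⟨e₁⟩ := arrow_cokernel (hcs l).some
        exact ⟨j, hj, hc.congr e₁, l, rfl⟩
    have hnz : ∀ l, ¬ IsZero (cokernel (f' l)) := by
      intro l
      induction l using Fin.lastCases with
      | last =>
        obtain ⟨e₁⟩ := arrow_cokernel ela
        have e₂ : cokernel (e.hom ≫ kernel.ι g) ≅ cokernel (kernel.ι g) :=
          cokernelEpiComp e.hom (kernel.ι g)
        have e₃ : cokernel (kernel.ι g) ≅ Q :=
          IsColimit.coconePointUniqueUpToIso (colimit.isColimit _)
            (Abelian.epiIsCokernelOfKernel _ (kernelIsKernel g))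
        exact fun hz => hQ0 (hz.of_iso (e₁ ≪≫ e₂ ≪≫ e₃).symm)
      | cast l =>
        obtain ⟨e₁⟩ := arrow_cokernel (hcs l).some
        exact fun hz => (hn.semistable l).1 (hz.of_iso e₁.symm)
    refine ⟨{ d := hn.d + 1
              F := F'
              isZero_bot := by rw [h0]; exact hn.isZero_bot
              top_iso := ⟨eqToIso hl⟩
              f := f'
              mono := ?_
              semistable := ?_
              phases_strictAnti := ?_ }, ?_⟩
    · intro l
      induction l using Fin.lastCases with
      | last => exact arrow_mono ela (mono_comp _ _)
      | cast l => exact arrow_mono (hcs l).some (hn.mono l)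
    · intro l
      rcases hcok l with ⟨hc, _⟩ | ⟨j, _, hc, _⟩
      · exact copies_semistable Z hZ (hst s) hc (hnz l)
      · exact copies_semistable Z hZ (hst j) hc (hnz l)
    · intro l l' hll
      rcases hcok l with ⟨hc, rfl⟩ | ⟨j, hj, hc, a, rfl⟩
      · exact absurd hll (not_lt.2 (Fin.le_last _))
      · rcases hcok l' with ⟨hc', rfl⟩ | ⟨j', hj', hc', a', rfl⟩
        · rw [copies_phase Z hZ (hst s) hc' (hnz _), copies_phase Z hZ (hst j) hc (hnz _)]
          exact hlt s j hj
        · obtain ⟨e₁⟩ := arrow_cokernel (hcs a).some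
          obtain ⟨e₂⟩ := arrow_cokernel (hcs a').some
          rw [K0.cls_iso e₁, K0.cls_iso e₂]
          exact hn.phases_strictAnti a a' hll
    · intro l
      rcases hcok l with ⟨hc, _⟩ | ⟨j, hj, hc, _⟩
      · exact ⟨s, le_rfl, hc⟩
      · exact ⟨j, le_of_lt hj, hc⟩

theorem forward_direction (D : DeligneData k C n) (h : D.IsHighestWeight) :
      ∃ Z : K0 C →+ ℂ, IsStabilityFunction Z ∧
        (∀ i, IsZStable Z (D.Δ i)) ∧
        (∀ i j : Fin n, i < j →
          phase (Z (K0.cls (D.Δ i))) < phase (Z (K0.cls (D.Δ j)))) ∧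
        (∀ i, ∃ hn : HNFiltration Z (D.P i), ∀ l : Fin hn.d,
          ∃ (N : ℕ) (g : Fin N → Fin n), (∀ a, i ≤ g a) ∧
            Nonempty (cokernel (hn.f l) ≅ ⨁ (fun a : Fin N => D.Δ (g a)))) := by
  let B : ℕ := (∑ i, D.len (D.Δ i)) + 1
  have hB : ∀ i, D.len (D.Δ i) < B := fun i =>
    Nat.lt_succ_of_le (Finset.single_le_sum (f := fun i => D.len (D.Δ i))
      (fun _ _ => Nat.zero_le _) (Finset.mem_univ i))
  have hst : ∀ i, IsZStable (D.stab B) (D.Δ i) := fun i =>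
    ⟨D.not_isZero_Δ i, fun Y f hf hY hi =>
      D.stab_lt B i (hB i) hY (fun j hj => D.sub_Δ (h i).1 f hi j hj)⟩
  have hlt : ∀ i j : Fin n, i < j →
      phase (D.stab B (K0.cls (D.Δ i))) < phase (D.stab B (K0.cls (D.Δ j))) := fun i j hij =>
    D.stab_lt B j (hB j) (D.not_isZero_Δ i) (fun l hl => D.mult_Δ (lt_of_lt_of_le hij hl))
  refine ⟨D.stab B, D.stab_isStab B, hst, hlt, fun i => ?_⟩
  obtain ⟨hn, hh⟩ := D.exists_hn (D.stab B) (D.stab_isStab B) hst hlt n i (by omega) (D.P i) (h i).2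
  refine ⟨hn, fun l => ?_⟩
  obtain ⟨j, hj, N, hN⟩ := hh l
  exact ⟨N, fun _ => j, fun _ => hj, hN⟩

/-- **Theorem 2** (stability criterion). A Deligne-finite `k`-linear abelian category with a
fixed ordering of its simple objects is highest weight with respect to this ordering if and
only if it admits a stability function `Z` for which the standard objects `Δ 0, …, Δ (n-1)`
are `Z`-stable of strictly increasing phase, and for each `i` the Harder–Narasimhan factors
of `P i` are direct sums of copies of the standard objects `Δ j` with `j ≥ i`. -/
theorem highestWeight_iff_stabilityFunction (D : DeligneData k C n) :
    D.IsHighestWeight ↔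
      ∃ Z : K0 C →+ ℂ, IsStabilityFunction Z ∧
        (∀ i, IsZStable Z (D.Δ i)) ∧
        (∀ i j : Fin n, i < j →
          phase (Z (K0.cls (D.Δ i))) < phase (Z (K0.cls (D.Δ j)))) ∧
        (∀ i, ∃ hn : HNFiltration Z (D.P i), ∀ l : Fin hn.d,
          ∃ (N : ℕ) (g : Fin N → Fin n), (∀ a, i ≤ g a) ∧
            Nonempty (cokernel (hn.f l) ≅ ⨁ (fun a : Fin N => D.Δ (g a)))) := by
  constructor
  · exact forward_direction D
  · rintro ⟨Z, hZ, hst, _, hhn⟩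
    exact reverse_direction D Z hZ hst hhn

end HWPaper
end

section
/- Let A be a Deligne-finite k-linear abelian category over an algebraically closed field k which is highest weight with respect to a fixed ordering S_1,…,S_n of its simple objects, with standard objects Δ_i and costandard objects ∇_j. Then Ext^r_A(Δ_i, ∇_j) ≅ k when i = j and r = 0, and Ext^r_A(Δ_i, ∇_j) = 0 otherwise. Consequently the classes [Δ_1],…,[Δ_n] and [∇_1],…,[∇_n] are dual bases of K(A) for the Euler form: χ([Δ_i],[∇_j]) = δ_{ij}. -/
open CategoryTheory CategoryTheory.Limits

universe v u

namespace HWPaper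

variable {C : Type u} [Category.{v} C]

variable {k : Type v} [Field k] [IsAlgClosed k] [Abelian C] [Linear k C]
  [EnoughProjectives C] {n : ℕ}

set_option linter.unusedSectionVars false

/-- Vanishing of derived-category Ext gives vanishing of the derived-functor Ext. -/
lemma ext_subsingleton_of_abelian [HasExt.{v} C] (X Y : C) (r : ℕ)
    (h : Subsingleton (Abelian.Ext.{v} X Y (r + 1))) :
    Subsingleton (((Ext k C (r + 1)).obj (Opposite.op X)).obj Y) := by
  let R := projectiveResolution X
  apply ModuleCat.subsingleton_of_isZero
  refine IsZero.of_iso ?_ (R.isoExt (R := k) (r + 1) Y)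
  rw [← HomologicalComplex.exactAt_iff_isZero_homology,
    HomologicalComplex.exactAt_iff' _ r (r + 1) (r + 2) (by simp) (by simp),
    ShortComplex.moduleCat_exact_iff]
  intro (f : R.complex.X (r + 1) ⟶ Y) hf
  have hf' : R.complex.d (r + 2) (r + 1) ≫ f = 0 := hf
  obtain ⟨g, hg⟩ := (R.extMk_eq_zero_iff f (r + 2) rfl hf' r rfl).1 (Subsingleton.elim _ _)
  exact ⟨g, hg⟩

/-- `Ext^0` is `Hom`. -/
lemma ext_zero_equiv (X Y : C) :
    Nonempty ((X ⟶ Y) ≃ₗ[k] (((Ext k C 0).obj (Opposite.op X)).obj Y)) := by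
  let R := projectiveResolution X
  let K := R.complex.linearYonedaObj k Y
  obtain ⟨π, hπ, hepi, hex⟩ : ∃ (π : R.complex.X 0 ⟶ X) (w : R.complex.d 1 0 ≫ π = 0), Epi π ∧
      (ShortComplex.mk _ _ w).Exact :=
    ⟨R.π.f 0, R.complex_d_comp_π_f_zero, inferInstanceAs (Epi (R.π.f 0)), R.exact₀⟩
  have := hepi
  have hepi' : Epi (ShortComplex.mk _ _ hπ).g := hepi
  let φ : ModuleCat.of k (X ⟶ Y) ⟶ K.X 0 :=
    ModuleCat.ofHom (Linear.leftComp k Y π)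
  have hφ : φ ≫ K.d 0 1 = 0 := by
    ext (f : X ⟶ Y)
    change R.complex.d 1 0 ≫ π ≫ f = 0
    rw [← Category.assoc, hπ, zero_comp]
  let ψ := K.liftCycles φ 1 (by simp) hφ
  have hψ : ψ ≫ K.iCycles 0 = φ := by simp [ψ]
  have hinj : Function.Injective φ.hom := by
    intro f g h
    have h' : π ≫ f = π ≫ g := h
    exact (cancel_epi _).1 h'
  have hi : Function.Injective (K.iCycles 0).hom :=
    (ModuleCat.mono_iff_injective _).1 inferInstance
  have hb : Function.Bijective ψ.hom := by
    constructor
    · intro f g h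
      apply hinj
      rw [← hψ]
      simp [h]
    · intro z
      have hz : R.complex.d 1 0 ≫ ((K.iCycles 0).hom z : R.complex.X 0 ⟶ Y) = 0 := by
        have : (K.iCycles 0 ≫ K.d 0 1).hom z = 0 := by simp
        exact this
      refine ⟨hex.desc _ hz, hi ?_⟩
      have : (K.iCycles 0).hom (ψ.hom (hex.desc _ hz)) = φ.hom (hex.desc _ hz) := by
        rw [← hψ]; rfl
      rw [this]
      exact hex.g_desc _ hz
  have e1 := LinearEquiv.ofBijective ψ.hom hb
  have e2 := (K.isoHomologyπ₀ ≪≫ (R.isoExt (R := k) 0 Y).symm).toLinearEquiv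
  exact ⟨e1.trans e2⟩

lemma shortExact_of_mono {X Y : C} (f : X ⟶ Y) [Mono f] :
    (ShortComplex.mk f (cokernel.π f) (cokernel.condition f)).ShortExact :=
  { exact := ShortComplex.exact_cokernel f
    mono_f := ‹_›
    epi_g := inferInstanceAs (Epi (cokernel.π f)) }

lemma shortExact_of_epi {X Y : C} (f : X ⟶ Y) [Epi f] :
    (ShortComplex.mk (kernel.ι f) f (kernel.condition f)).ShortExact :=
  { exact := ShortComplex.exact_kernel f
    mono_f := inferInstanceAs (Mono (kernel.ι f))
    epi_g := ‹_› }

namespace DeligneData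

variable (D : DeligneData k C n)

lemma mult_zero {X : C} (h : IsZero X) (j : Fin n) : D.mult X j = 0 :=
  (D.mult_eq_zero_iff X).2 h j

lemma mult_mono_eq {X Y : C} (f : X ⟶ Y) [Mono f] (j : Fin n) :
    D.mult Y j = D.mult X j + D.mult (cokernel f) j :=
  D.mult_additive _ (shortExact_of_mono f) j

lemma mult_epi_eq {X Y : C} (f : X ⟶ Y) [Epi f] (j : Fin n) :
    D.mult X j = D.mult (kernel f) j + D.mult Y j :=
  D.mult_additive _ (shortExact_of_epi f) j

lemma mult_iso_s5 {X Y : C} (e : X ≅ Y) (j : Fin n) : D.mult X j = D.mult Y j := by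
  have h1 := D.mult_mono_eq e.hom j
  have h2 := D.mult_mono_eq e.inv j
  omega

/-- Every object is obtained by extensions from zero objects and simple objects. -/
lemma induct (p : C → Prop) (h0 : ∀ X, IsZero X → p X)
    (h1 : ∀ X i, (X ≅ D.S i) → p X)
    (h2 : ∀ T : ShortComplex C, T.ShortExact → p T.X₁ → p T.X₃ → p T.X₂) (X : C) : p X := by
  obtain ⟨N, hN⟩ : ∃ N, ∑ j, D.mult X j = N := ⟨_, rfl⟩
  induction N using Nat.strong_induction_on generalizing X with
  | _ N ih =>
    by_cases hX : IsZero X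
    · exact h0 X hX
    by_cases hs : Simple X
    · obtain ⟨i, ⟨e⟩⟩ := D.exhaustive X hs
      exact h1 X i e
    have pos : ∀ Z : C, ¬ IsZero Z → 0 < ∑ j, D.mult Z j := by
      intro Z hZ
      by_contra hcon
      apply hZ
      rw [← D.mult_eq_zero_iff]
      intro j
      have : ∑ j, D.mult Z j = 0 := by omega
      exact (Finset.sum_eq_zero_iff.1 this) j (Finset.mem_univ j)
    have : ∃ (Y : C) (f : Y ⟶ X), Mono f ∧ f ≠ 0 ∧ ¬ IsIso f := by
      by_contra hcon
      push Not at hcon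
      apply hs
      constructor
      intro Y f hf
      constructor
      · rintro hi rfl
        apply hX
        rw [IsZero.iff_id_eq_zero, ← cancel_epi (0 : Y ⟶ X)]
        simp
      · exact hcon Y f hf
    obtain ⟨Y, f, hf, hne, hni⟩ := this
    have hY : ¬ IsZero Y := fun h => hne (h.eq_of_src _ _)
    have hQ : ¬ IsZero (cokernel f) := by
      intro h
      apply hni
      have : Epi f := Abelian.epi_of_cokernel_π_eq_zero _ (h.eq_of_tgt _ _)
      exact isIso_of_mono_of_epi f
    have hsum : ∑ j, D.mult X j = ∑ j, D.mult Y j + ∑ j, D.mult (cokernel f) j := by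
      rw [← Finset.sum_add_distrib]
      exact Finset.sum_congr rfl (fun j _ => D.mult_mono_eq f j)
    have p1 := pos _ hY
    have p2 := pos _ hQ
    exact h2 _ (shortExact_of_mono f) (ih _ (by omega) Y rfl) (ih _ (by omega) (cokernel f) rfl)

lemma serre_iff_s5 (i : Fin n) (X : C) : D.serre i X ↔ ∀ l, i < l → D.mult X l = 0 := by
  constructor
  · intro h
    induction h with
    | of X hX =>
      obtain ⟨j, hj, ⟨e⟩⟩ := hX
      intro l hl
      rw [D.mult_iso_s5 e, D.mult_simple, if_neg]
      rintro rfl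
      exact absurd hl (not_lt.2 hj)
    | zero X hX => exact fun l _ => D.mult_zero hX l
    | ext S hS _ _ h1 h3 =>
      intro l hl
      rw [D.mult_additive S hS, h1 l hl, h3 l hl]
  · refine D.induct (fun X => (∀ l, i < l → D.mult X l = 0) → D.serre i X) ?_ ?_ ?_ X
    · exact fun X hX _ => ExtClosure.zero X hX
    · intro X j e h
      refine ExtClosure.of X ⟨j, ?_, ⟨e⟩⟩
      by_contra hj
      have := h j (not_le.1 hj)
      rw [D.mult_iso_s5 e, D.mult_simple, if_pos rfl] at this
      omega
    · intro T hT h1 h3 h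
      have := fun l hl => (D.mult_additive T hT l).symm.trans (h l hl)
      exact ExtClosure.ext T hT (h1 fun l hl => by have := this l hl; omega)
        (h3 fun l hl => by have := this l hl; omega)

lemma serre_std (i : Fin n) : D.serre i (D.Δ i) := (D.std i).2.1

lemma serre_costd (i : Fin n) : D.serre i (D.nabla i) := (D.costd i).2.1

lemma serre_mono {i j : Fin n} (h : i ≤ j) {X : C} (hX : D.serre i X) : D.serre j X := by
  rw [serre_iff_s5] at *
  exact fun l hl => hX l (lt_of_le_of_lt h hl)

lemma mult_image_le_left {X Y : C} (f : X ⟶ Y) (l : Fin n) :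
    D.mult X l ≤ D.mult (kernel f) l + D.mult Y l := by
  have h1 := D.mult_epi_eq (factorThruImage f) l
  have h2 := D.mult_mono_eq (image.ι f) l
  have e : kernel (factorThruImage f) ≅ kernel f :=
    (kernelCompMono (factorThruImage f) (image.ι f)).symm ≪≫ kernelIsoOfEq (image.fac f)
  rw [D.mult_iso_s5 e] at h1
  omega

lemma mult_image_le_right {X Y : C} (f : X ⟶ Y) (l : Fin n) :
    D.mult Y l ≤ D.mult X l + D.mult (cokernel f) l := by
  have h1 := D.mult_epi_eq (factorThruImage f) l
  have h2 := D.mult_mono_eq (image.ι f) l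
  have e : cokernel (image.ι f) ≅ cokernel f :=
    (cokernelEpiComp (factorThruImage f) (image.ι f)).symm ≪≫ cokernelIsoOfEq (image.fac f)
  rw [D.mult_iso_s5 e] at h2
  omega

/-- A morphism from the kernel of `P j ⟶ Δ j` to an object of `A_j` vanishes. -/
lemma kernel_std_hom_eq_zero (j : Fin n) {Y : C} (hY : D.serre j Y)
    (f : kernel (D.q j) ⟶ Y) : f = 0 := by
  have := (D.std j).1
  let K' : kernel f ⟶ D.P j := kernel.ι f ≫ kernel.ι (D.q j)
  have hQ : D.serre j (cokernel K') := by
    rw [serre_iff_s5]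
    intro l hl
    have h1 := D.mult_mono_eq K' l
    have h2 := D.mult_epi_eq (D.q j) l
    have h3 := D.mult_image_le_left f l
    have h4 := (D.serre_iff_s5 j Y).1 hY l hl
    have h5 := (D.serre_iff_s5 j _).1 (D.serre_std j) l hl
    omega
  obtain ⟨r, hr⟩ := (D.std j).2.2 (cokernel.π K') inferInstance hQ
  have h0 : kernel.ι (D.q j) ≫ cokernel.π K' = 0 := by
    rw [← hr, kernel.condition_assoc, zero_comp]
  have hex := (shortExact_of_mono K').exact
  have : Mono (ShortComplex.mk K' (cokernel.π K') (cokernel.condition K')).f :=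
    inferInstanceAs (Mono K')
  obtain ⟨t, ht⟩ : ∃ t : kernel (D.q j) ⟶ kernel f, t ≫ K' = kernel.ι (D.q j) :=
    ⟨hex.lift _ h0, hex.lift_f _ h0⟩
  have ht' : t ≫ kernel.ι f = 𝟙 _ := by
    rw [← cancel_mono (kernel.ι (D.q j)), Category.assoc, Category.id_comp]
    exact ht
  rw [← Category.id_comp f, ← ht', Category.assoc, kernel.condition, comp_zero]

/-- A morphism from an object of `A_j` to the cokernel of `∇ j ⟶ I j` vanishes. -/
lemma hom_cokernel_costd_eq_zero (j : Fin n) {X : C} (hX : D.serre j X)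
    (g : X ⟶ cokernel (D.m j)) : g = 0 := by
  have := (D.costd j).1
  let K' : D.I j ⟶ cokernel g := cokernel.π (D.m j) ≫ cokernel.π g
  have hM : D.serre j (kernel K') := by
    rw [serre_iff_s5]
    intro l hl
    have h1 := D.mult_epi_eq K' l
    have h2 := D.mult_mono_eq (D.m j) l
    have h3 := D.mult_image_le_right g l
    have h4 := (D.serre_iff_s5 j X).1 hX l hl
    have h5 := (D.serre_iff_s5 j _).1 (D.serre_costd j) l hl
    omega
  obtain ⟨r, hr⟩ := (D.costd j).2.2 (kernel.ι K') inferInstance hM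
  have h0 : kernel.ι K' ≫ cokernel.π (D.m j) = 0 := by
    rw [← hr, Category.assoc, cokernel.condition, comp_zero]
  have hex := (shortExact_of_epi K').exact
  have : Epi (ShortComplex.mk (kernel.ι K') K' (kernel.condition K')).g :=
    inferInstanceAs (Epi K')
  obtain ⟨t, ht⟩ : ∃ t : cokernel g ⟶ cokernel (D.m j), K' ≫ t = cokernel.π (D.m j) :=
    ⟨hex.desc _ h0, hex.g_desc _ h0⟩
  have ht' : cokernel.π g ≫ t = 𝟙 _ := by
    rw [← cancel_epi (cokernel.π (D.m j)), ← Category.assoc, Category.comp_id]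
    exact ht
  rw [← Category.comp_id g, ← ht', ← Category.assoc, cokernel.condition, zero_comp]

lemma finrank_simple_hom (i j : Fin n) :
    Module.finrank k (D.S i ⟶ D.S j) = if i = j then 1 else 0 := by
  have := D.simple i
  have := D.simple j
  have := D.homFinite
  split_ifs with h
  · subst h
    exact finrank_endomorphism_simple_eq_one k (D.S i)
  · rw [finrank_hom_simple_simple_eq_zero_iff]
    exact ⟨fun e => h (D.distinct i j ⟨e⟩)⟩

lemma projCover_factor {P S X : C} {p : P ⟶ S} (hp : IsProjCover P S p) [Simple S] [Simple X]
    (f : P ⟶ X) : ∃ g : S ⟶ X, p ≫ g = f := by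
  have := hp.2.1
  by_cases hf : f = 0
  · exact ⟨0, by simp [hf]⟩
  have : Epi f := epi_of_nonzero_to_simple hf
  by_cases h : kernel.ι f ≫ p = 0
  · have hex := (shortExact_of_epi f).exact
    have : Epi (ShortComplex.mk (kernel.ι f) f (kernel.condition f)).g := inferInstanceAs (Epi f)
    obtain ⟨t, ht⟩ : ∃ t : X ⟶ S, f ≫ t = p := ⟨hex.desc _ h, hex.g_desc _ h⟩
    have hp0 : p ≠ 0 := by
      intro h0
      apply id_nonzero S
      rw [← cancel_epi p, h0, zero_comp, zero_comp]
    have ht0 : t ≠ 0 := by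
      rintro rfl
      exact hp0 (by rw [← ht, comp_zero])
    have := isIso_of_hom_simple ht0
    exact ⟨inv t, by rw [← ht, Category.assoc, IsIso.hom_inv_id, Category.comp_id]⟩
  · have : Epi (kernel.ι f ≫ p) := epi_of_nonzero_to_simple h
    have := hp.2.2 _ this
    exact absurd (by rw [← cancel_epi (kernel.ι f), kernel.condition, comp_zero]) hf

lemma injHull_factor {I S X : C} {p : S ⟶ I} (hp : IsInjHull S I p) [Simple S] [Simple X]
    (f : X ⟶ I) : ∃ g : X ⟶ S, g ≫ p = f := by
  have := hp.2.1
  by_cases hf : f = 0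
  · exact ⟨0, by simp [hf]⟩
  have : Mono f := mono_of_nonzero_from_simple hf
  by_cases h : p ≫ cokernel.π f = 0
  · have hex := (shortExact_of_mono f).exact
    have : Mono (ShortComplex.mk f (cokernel.π f) (cokernel.condition f)).f :=
      inferInstanceAs (Mono f)
    obtain ⟨t, ht⟩ : ∃ t : S ⟶ X, t ≫ f = p := ⟨hex.lift _ h, hex.lift_f _ h⟩
    have hp0 : p ≠ 0 := by
      intro h0
      apply id_nonzero S
      rw [← cancel_mono p, h0, comp_zero, comp_zero]
    have ht0 : t ≠ 0 := by
      rintro rfl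
      exact hp0 (by rw [← ht, zero_comp])
    have := isIso_of_hom_simple ht0
    exact ⟨inv t, by rw [← ht, ← Category.assoc, IsIso.inv_hom_id, Category.id_comp]⟩
  · have : Mono (p ≫ cokernel.π f) := mono_of_nonzero_from_simple h
    have := hp.2.2 _ this
    exact absurd (by rw [← cancel_mono (cokernel.π f), cokernel.condition, zero_comp]) hf

lemma finrank_exact {U V W : Type v} [AddCommGroup U] [AddCommGroup V] [AddCommGroup W]
    [Module k U] [Module k V] [Module k W] [FiniteDimensional k V]
    (f : U →ₗ[k] V) (g : V →ₗ[k] W) (hf : Function.Injective f) (hg : Function.Surjective g)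
    (h : Function.Exact f g) :
    Module.finrank k V = Module.finrank k U + Module.finrank k W := by
  rw [← LinearMap.finrank_range_add_finrank_ker g, LinearMap.range_eq_top.2 hg, finrank_top,
    h.linearMap_ker_eq, LinearMap.finrank_range_of_inj hf, add_comm]

lemma finrank_proj_hom (i : Fin n) (X : C) :
    Module.finrank k (D.P i ⟶ X) = D.mult X i := by
  have := D.homFinite
  have := (D.projCover i).1
  have := (D.projCover i).2.1
  refine D.induct (fun X => Module.finrank k (D.P i ⟶ X) = D.mult X i) ?_ ?_ ?_ X
  · intro X hX
    have : Subsingleton (D.P i ⟶ X) := ⟨fun a b => hX.eq_of_tgt a b⟩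
    rw [Module.finrank_zero_of_subsingleton, D.mult_zero hX]
  · intro X j e
    have := D.simple i
    have : Simple X := by have := D.simple j; exact Simple.of_iso e
    let φ : (D.S i ⟶ X) →ₗ[k] (D.P i ⟶ X) := Linear.leftComp k X (D.p i)
    have hφ : Function.Bijective φ := by
      constructor
      · intro a b h
        exact (cancel_epi (D.p i)).1 h
      · intro f
        obtain ⟨g, hg⟩ := projCover_factor (D.projCover i) f
        exact ⟨g, hg⟩
    have e1 := (LinearEquiv.ofBijective φ hφ).finrank_eq
    have e2 := (Linear.homCongr k (Iso.refl (D.S i)) e).finrank_eq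
    rw [← e1, e2, D.finrank_simple_hom, D.mult_iso_s5 e, D.mult_simple]
    simp [eq_comm]
  · intro T hT h1 h3
    have := hT.mono_f
    have := hT.epi_g
    rw [D.mult_additive T hT, ← h1, ← h3]
    refine finrank_exact (Linear.rightComp k (D.P i) T.f) (Linear.rightComp k (D.P i) T.g)
      ?_ ?_ ?_
    · intro a b h
      exact (cancel_mono T.f).1 h
    · intro a
      exact ⟨Projective.factorThru a T.g, Projective.factorThru_comp a T.g⟩
    · intro a
      constructor
      · intro (h : a ≫ T.g = 0)
        exact ⟨hT.exact.lift a h, hT.exact.lift_f a h⟩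
      · rintro ⟨b, rfl⟩
        change (b ≫ T.f) ≫ T.g = 0
        simp

lemma finrank_hom_inj (i : Fin n) (X : C) :
    Module.finrank k (X ⟶ D.I i) = D.mult X i := by
  have := D.homFinite
  have := (D.injHull i).1
  have := (D.injHull i).2.1
  refine D.induct (fun X => Module.finrank k (X ⟶ D.I i) = D.mult X i) ?_ ?_ ?_ X
  · intro X hX
    have : Subsingleton (X ⟶ D.I i) := ⟨fun a b => hX.eq_of_src a b⟩
    rw [Module.finrank_zero_of_subsingleton, D.mult_zero hX]
  · intro X j e
    have := D.simple i
    have : Simple X := by have := D.simple j; exact Simple.of_iso e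
    let φ : (X ⟶ D.S i) →ₗ[k] (X ⟶ D.I i) := Linear.rightComp k X (D.ι i)
    have hφ : Function.Bijective φ := by
      constructor
      · intro a b h
        exact (cancel_mono (D.ι i)).1 h
      · intro f
        obtain ⟨g, hg⟩ := injHull_factor (D.injHull i) f
        exact ⟨g, hg⟩
    have e1 := (LinearEquiv.ofBijective φ hφ).finrank_eq
    have e2 := (Linear.homCongr k e (Iso.refl (D.S i))).finrank_eq
    rw [← e1, e2, D.finrank_simple_hom, D.mult_iso_s5 e, D.mult_simple]
  · intro T hT h1 h3
    have := hT.mono_f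
    have := hT.epi_g
    rw [D.mult_additive T hT, ← h1, ← h3, add_comm]
    refine finrank_exact (Linear.leftComp k (D.I i) T.g) (Linear.leftComp k (D.I i) T.f)
      ?_ ?_ ?_
    · intro a b h
      exact (cancel_epi T.g).1 h
    · intro a
      exact ⟨Injective.factorThru a T.f, Injective.comp_factorThru a T.f⟩
    · intro a
      constructor
      · intro (h : T.f ≫ a = 0)
        exact ⟨hT.exact.desc a h, hT.exact.g_desc a h⟩
      · rintro ⟨b, rfl⟩
        change T.f ≫ T.g ≫ b = 0
        simp

/-- `Hom(Δ l, Y) = 0` if `S l` is not a composition factor of `Y`. -/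
lemma hom_std_eq_zero {l : Fin n} {Y : C} (h : D.mult Y l = 0) (f : D.Δ l ⟶ Y) : f = 0 := by
  have := D.homFinite
  have := (D.std l).1
  rw [← D.finrank_proj_hom, Module.finrank_zero_iff] at h
  rw [← cancel_epi (D.q l)]
  exact Subsingleton.elim _ _

lemma hom_costd_eq_zero {l : Fin n} {X : C} (h : D.mult X l = 0) (f : X ⟶ D.nabla l) : f = 0 := by
  have := D.homFinite
  have := (D.costd l).1
  rw [← D.finrank_hom_inj, Module.finrank_zero_iff] at h
  rw [← cancel_mono (D.m l)]
  exact Subsingleton.elim _ _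

lemma hom_std_costd_eq_zero {i j : Fin n} (h : i ≠ j) (f : D.Δ i ⟶ D.nabla j) : f = 0 := by
  rcases lt_or_gt_of_ne h with h | h
  · exact D.hom_costd_eq_zero ((D.serre_iff_s5 i _).1 (D.serre_std i) j h) f
  · exact D.hom_std_eq_zero ((D.serre_iff_s5 j _).1 (D.serre_costd j) i h) f

lemma mult_std_self (hhw : D.IsHighestWeight) (i : Fin n) : D.mult (D.Δ i) i = 1 := by
  have := (D.std i).1
  let φ : (D.Δ i ⟶ D.Δ i) →ₗ[k] (D.P i ⟶ D.Δ i) := Linear.leftComp k _ (D.q i)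
  have hφ : Function.Bijective φ := by
    constructor
    · intro a b h
      exact (cancel_epi (D.q i)).1 h
    · intro f
      have hex := (shortExact_of_epi (D.q i)).exact
      have : Epi (ShortComplex.mk (kernel.ι (D.q i)) (D.q i) (kernel.condition _)).g :=
        inferInstanceAs (Epi (D.q i))
      have h := D.kernel_std_hom_eq_zero i (D.serre_std i) (kernel.ι (D.q i) ≫ f)
      exact ⟨hex.desc f h, hex.g_desc f h⟩
  rw [← D.finrank_proj_hom, ← (LinearEquiv.ofBijective φ hφ).finrank_eq]
  obtain ⟨e⟩ := (hhw i).1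
  have : Module.finrank k (End (D.Δ i)) = 1 := by
    rw [e.toLinearEquiv.finrank_eq, Module.finrank_self]
  exact this

lemma finrank_std_costd_self (hhw : D.IsHighestWeight) (i : Fin n) :
    Module.finrank k (D.Δ i ⟶ D.nabla i) = 1 := by
  have := (D.costd i).1
  let φ : (D.Δ i ⟶ D.nabla i) →ₗ[k] (D.Δ i ⟶ D.I i) := Linear.rightComp k _ (D.m i)
  have hφ : Function.Bijective φ := by
    constructor
    · intro a b h
      exact (cancel_mono (D.m i)).1 h
    · intro f
      have hex := (shortExact_of_mono (D.m i)).exact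
      have : Mono (ShortComplex.mk (D.m i) (cokernel.π (D.m i)) (cokernel.condition _)).f :=
        inferInstanceAs (Mono (D.m i))
      have h := D.hom_cokernel_costd_eq_zero i (D.serre_std i) (f ≫ cokernel.π (D.m i))
      exact ⟨hex.lift f h, hex.lift_f f h⟩
  rw [(LinearEquiv.ofBijective φ hφ).finrank_eq, D.finrank_hom_inj, D.mult_std_self hhw]

open ZeroObject

section ext

variable [HasExt.{v} C]

lemma ext_one_std_eq_zero (j : Fin n) {Y : C} (hY : D.serre j Y) :
    Subsingleton (Abelian.Ext.{v} (D.Δ j) Y 1) := by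
  have := (D.std j).1
  have := (D.projCover j).1
  refine subsingleton_of_forall_eq 0 fun x => ?_
  obtain ⟨y, rfl⟩ := Abelian.Ext.contravariant_sequence_exact₃ (shortExact_of_epi (D.q j)) Y x
    (Abelian.Ext.eq_zero_of_projective (P := D.P j) (n := 0) _) (n₀ := 0) rfl
  obtain ⟨f, rfl⟩ := (Abelian.Ext.mk₀_bijective _ _).2 y
  rw [D.kernel_std_hom_eq_zero j hY f]
  simp

lemma ext_one_costd_eq_zero (j : Fin n) {X : C} (hX : D.serre j X) :
    Subsingleton (Abelian.Ext.{v} X (D.nabla j) 1) := by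
  have := (D.costd j).1
  have := (D.injHull j).1
  refine subsingleton_of_forall_eq 0 fun x => ?_
  obtain ⟨y, rfl⟩ := Abelian.Ext.covariant_sequence_exact₁ X (shortExact_of_mono (D.m j)) x
    (Abelian.Ext.eq_zero_of_injective (I := D.I j) (n := 0) _) (n₀ := 0) rfl
  obtain ⟨f, rfl⟩ := (Abelian.Ext.mk₀_bijective _ _).2 y
  rw [D.hom_cokernel_costd_eq_zero j hX f]
  simp

/-- The vanishing properties satisfied by objects filtered by `Δ l` with `l > i`. -/
def Good (i : Fin n) (X : C) : Prop :=
  (∀ Y, D.serre i Y → (∀ f : X ⟶ Y, f = 0) ∧ Subsingleton (Abelian.Ext.{v} X Y 1)) ∧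
    ∀ j r, Subsingleton (Abelian.Ext.{v} X (D.nabla j) (r + 1))

lemma ext_subsingleton_middle {S : ShortComplex C} (hS : S.ShortExact) (Y : C) (r : ℕ)
    (h1 : Subsingleton (Abelian.Ext.{v} S.X₁ Y r)) (h3 : Subsingleton (Abelian.Ext.{v} S.X₃ Y r)) :
    Subsingleton (Abelian.Ext.{v} S.X₂ Y r) := by
  refine subsingleton_of_forall_eq 0 fun x => ?_
  obtain ⟨y, rfl⟩ := Abelian.Ext.contravariant_sequence_exact₂ hS Y x (Subsingleton.elim _ _)
  rw [Subsingleton.elim y 0]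
  simp

lemma good_zero (i : Fin n) {X : C} (hX : IsZero X) : D.Good i X := by
  have key : ∀ Y r, Subsingleton (Abelian.Ext.{v} X Y (r + 1)) := by
    intro Y r
    have : Projective X := ⟨fun {E X'} f e _ => ⟨0, hX.eq_of_src _ _⟩⟩
    exact Abelian.Ext.subsingleton_of_projective X Y r
  exact ⟨fun Y _ => ⟨fun f => hX.eq_of_src _ _, key Y 0⟩, fun j r => key _ r⟩

lemma good_ext (i : Fin n) {S : ShortComplex C} (hS : S.ShortExact) (h1 : D.Good i S.X₁)
    (h3 : D.Good i S.X₃) : D.Good i S.X₂ := by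
  have := hS.epi_g
  refine ⟨fun Y hY => ⟨fun f => ?_, ext_subsingleton_middle hS _ _ (h1.1 Y hY).2 (h3.1 Y hY).2⟩,
    fun j r => ext_subsingleton_middle hS _ _ (h1.2 j r) (h3.2 j r)⟩
  have h := (h1.1 Y hY).1 (S.f ≫ f)
  rw [← hS.exact.g_desc f h, (h3.1 Y hY).1 (hS.exact.desc f h), comp_zero]

/-- A decomposition of `X` into a good subobject and a quotient in `A_i`. -/
def Decomp (i : Fin n) (X : C) : Prop :=
  ∃ (X' : C) (a : X' ⟶ X), Mono a ∧ D.Good i X' ∧ D.serre i (cokernel a)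

lemma decomp_ext (i : Fin n) {S : ShortComplex C} (hS : S.ShortExact) (h1 : D.Decomp i S.X₁)
    (h3 : D.Decomp i S.X₃) : D.Decomp i S.X₂ := by
  obtain ⟨A', a, ha, hA, hA''⟩ := h1
  obtain ⟨B', b, hb, hB, hB''⟩ := h3
  have := hS.mono_f
  have := hS.epi_g
  let a' : A' ⟶ S.X₂ := a ≫ S.f
  have hw : a' ≫ S.g = 0 := by simp [a']
  let c : S.X₂ ⟶ cokernel a' := cokernel.π a'
  let d : cokernel a' ⟶ S.X₃ := cokernel.desc a' S.g hw
  have hcd : c ≫ d = S.g := cokernel.π_desc _ _ _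
  have hd : Epi d := by
    have : Epi (c ≫ d) := by rw [hcd]; infer_instance
    exact epi_of_epi c d
  rw [serre_iff_s5] at hA'' hB''
  have hN : D.serre i (kernel d) := by
    rw [serre_iff_s5]
    intro l hl
    have e1 := D.mult_epi_eq d l
    have e2 := D.mult_mono_eq a' l
    have e3 := D.mult_additive S hS l
    have e4 := D.mult_mono_eq a l
    have e5 := hA'' l hl
    omega
  -- lift `b` through `d`
  have hE := (hB.1 _ hN).2
  obtain ⟨s, hs⟩ : ∃ s : B' ⟶ cokernel a', s ≫ d = b := by
    obtain ⟨y, hy⟩ := Abelian.Ext.covariant_sequence_exact₃ B' (shortExact_of_epi d)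
      (Abelian.Ext.mk₀ b) (n₁ := 1) rfl (Subsingleton.elim _ _)
    obtain ⟨s, rfl⟩ := (Abelian.Ext.mk₀_bijective _ _).2 y
    rw [Abelian.Ext.mk₀_comp_mk₀] at hy
    exact ⟨s, (Abelian.Ext.mk₀_bijective _ _).1 hy⟩
  have hsm : Mono s := by
    have : Mono (s ≫ d) := by rw [hs]; exact hb
    exact mono_of_mono s d
  have hac : a' ≫ c = 0 := cokernel.condition a'
  let u : A' ⟶ pullback c s := pullback.lift a' 0 (by simp [hac])
  have hu1 : u ≫ pullback.fst c s = a' := pullback.lift_fst _ _ _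
  have hu2 : u ≫ pullback.snd c s = 0 := pullback.lift_snd _ _ _
  have hum : Mono u := by
    have : Mono (u ≫ pullback.fst c s) := by rw [hu1]; infer_instance
    exact mono_of_mono u (pullback.fst c s)
  have hexa := (shortExact_of_mono a').exact
  have hma : Mono (ShortComplex.mk a' (cokernel.π a') (cokernel.condition a')).f :=
    inferInstanceAs (Mono a')
  have hT : (ShortComplex.mk u (pullback.snd c s) hu2).ShortExact :=
    { exact := by
        refine ShortComplex.exact_of_f_is_kernel _ (KernelFork.IsLimit.ofι' _ _ fun {W} t ht => ?_)
        have h0 : (t ≫ pullback.fst c s) ≫ c = 0 := by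
          rw [Category.assoc, pullback.condition, ← Category.assoc]
          erw [ht]
          rw [zero_comp]
        refine ⟨hexa.lift (t ≫ pullback.fst c s) h0, ?_⟩
        have hl : hexa.lift (t ≫ pullback.fst c s) h0 ≫ a' = t ≫ pullback.fst c s :=
          hexa.lift_f _ h0
        apply pullback.hom_ext
        · rw [Category.assoc]
          exact (congrArg _ hu1).trans hl
        · rw [Category.assoc]
          refine (congrArg _ hu2).trans ?_
          rw [comp_zero]
          exact ht.symm
      mono_f := hum
      epi_g := inferInstanceAs (Epi (pullback.snd c s)) }
  refine ⟨pullback c s, pullback.fst c s, inferInstance, D.good_ext i hT hA hB, ?_⟩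
  rw [serre_iff_s5]
  intro l hl
  have e1 := D.mult_mono_eq (pullback.fst c s) l
  have e2 : D.mult (pullback c s) l = D.mult A' l + D.mult B' l := D.mult_additive _ hT l
  have e3 := D.mult_additive S hS l
  have e4 := D.mult_mono_eq a l
  have e5 := D.mult_mono_eq b l
  have e6 := hA'' l hl
  have e7 := hB'' l hl
  omega

theorem ext_succ_eq_zero (hhw : D.IsHighestWeight) (i : Fin n) :
    ∀ (j : Fin n) (r : ℕ), Subsingleton (Abelian.Ext.{v} (D.Δ i) (D.nabla j) (r + 1)) := by
  induction i using WellFoundedGT.induction with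
  | _ i ih =>
    have hgood : ∀ l, i < l → D.Good i (D.Δ l) := by
      intro l hl
      exact ⟨fun Y hY => ⟨fun f => D.hom_std_eq_zero ((D.serre_iff_s5 i Y).1 hY l hl) f,
        D.ext_one_std_eq_zero l (D.serre_mono hl.le hY)⟩, ih l hl⟩
    have hdec : ∀ X, ExtClosure (fun X => ∃ j, i ≤ j ∧ Nonempty (X ≅ D.Δ j)) X →
        D.Decomp i X := by
      intro X hX
      induction hX with
      | of X hX =>
        obtain ⟨l, hl, ⟨e⟩⟩ := hX
        rcases hl.eq_or_lt with rfl | hl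
        · refine ⟨0, 0, inferInstance, D.good_zero i (isZero_zero C), ?_⟩
          rw [serre_iff_s5]
          intro l hl
          have h := (D.serre_iff_s5 i _).1 (D.serre_std i) l hl
          have h1 := D.mult_mono_eq (0 : (0 : C) ⟶ X) l
          have h2 := D.mult_iso_s5 e l
          omega
        · refine ⟨D.Δ l, e.inv, inferInstance, hgood l hl, ?_⟩
          refine ExtClosure.zero _ ?_
          exact (isZero_zero C).of_iso (cokernel.ofEpi e.inv)
      | zero X hX =>
        refine ⟨X, 𝟙 X, inferInstance, D.good_zero i hX, ExtClosure.zero _ ?_⟩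
        exact (isZero_zero C).of_iso (cokernel.ofEpi (𝟙 X))
      | ext S hS _ _ h1 h3 => exact D.decomp_ext i hS h1 h3
    obtain ⟨X', a, ha, hX', hQ⟩ := hdec _ (hhw i).2
    have hqe := (D.std i).1
    have hproj := (D.projCover i).1
    -- the quotient is `Δ i`
    obtain ⟨r, hr⟩ := (D.std i).2.2 (cokernel.π a) inferInstance hQ
    have haq : a ≫ D.q i = 0 := (hX'.1 _ (D.serre_std i)).1 _
    let e : cokernel a ≅ D.Δ i :=
      { hom := cokernel.desc a (D.q i) haq
        inv := r
        hom_inv_id := by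
          rw [← cancel_epi (cokernel.π a), cokernel.π_desc_assoc, hr, Category.comp_id]
        inv_hom_id := by
          rw [← cancel_epi (D.q i), ← Category.assoc, hr, cokernel.π_desc, Category.comp_id] }
    have hT : (ShortComplex.mk a (D.q i) haq).ShortExact := by
      refine ShortComplex.shortExact_of_iso ?_ (shortExact_of_mono a)
      exact ShortComplex.isoMk (Iso.refl _) (Iso.refl _) e (by simp) (by simp [e])
    intro j r
    cases r with
    | zero =>
      rcases le_total i j with h | h
      · exact D.ext_one_costd_eq_zero j (D.serre_mono h (D.serre_std i))
      · exact D.ext_one_std_eq_zero i (D.serre_mono h (D.serre_costd j))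
    | succ r =>
      refine subsingleton_of_forall_eq 0 fun x => ?_
      obtain ⟨y, rfl⟩ := Abelian.Ext.contravariant_sequence_exact₃ hT (D.nabla j) x
        (Abelian.Ext.eq_zero_of_projective (P := D.P i) (n := r + 1) _) (n₀ := r + 1)
        (Nat.add_comm _ _)
      have := hX'.2 j r
      rw [Subsingleton.elim y 0]
      simp

end ext

end DeligneData

/-- **Lemma.** In a highest-weight category, `Ext^r(Δ i, ∇ j) ≅ k` if `i = j` and `r = 0`,
and `Ext^r(Δ i, ∇ j) = 0` otherwise.  Consequently the classes of the standard and of the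
costandard objects are dual bases for the Euler form:
`χ([Δ i], [∇ j]) = ∑_r (-1)^r dim Ext^r(Δ i, ∇ j) = δ_{i j}`. -/
theorem ext_std_costd (D : DeligneData k C n) (hhw : D.IsHighestWeight) (i j : Fin n) :
    (i = j → Nonempty ((((Ext k C 0).obj (Opposite.op (D.Δ i))).obj (D.nabla j)) ≃ₗ[k] k)) ∧
    (∀ r : ℕ, ¬ (i = j ∧ r = 0) →
      Subsingleton (((Ext k C r).obj (Opposite.op (D.Δ i))).obj (D.nabla j))) ∧
    (∑ᶠ r : ℕ, ((-1 : ℤ) ^ r *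
        (Module.finrank k (((Ext k C r).obj (Opposite.op (D.Δ i))).obj (D.nabla j)) : ℤ))) =
      if i = j then 1 else 0 := by
  have : HasExt.{v} C := hasExt_of_enoughProjectives.{v} C
  have h1 : i = j →
      Nonempty ((((Ext k C 0).obj (Opposite.op (D.Δ i))).obj (D.nabla j)) ≃ₗ[k] k) := by
    rintro rfl
    obtain ⟨e⟩ := ext_zero_equiv (k := k) (D.Δ i) (D.nabla i)
    have := D.homFinite
    have h := D.finrank_std_costd_self hhw i
    exact ⟨e.symm.trans (LinearEquiv.ofFinrankEq _ _ (by rw [h, Module.finrank_self]))⟩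
  have h2 : ∀ r : ℕ, ¬ (i = j ∧ r = 0) →
      Subsingleton (((Ext k C r).obj (Opposite.op (D.Δ i))).obj (D.nabla j)) := by
    intro r hr
    cases r with
    | zero =>
      have hij : i ≠ j := fun h => hr ⟨h, rfl⟩
      obtain ⟨e⟩ := ext_zero_equiv (k := k) (D.Δ i) (D.nabla j)
      have : Subsingleton (D.Δ i ⟶ D.nabla j) :=
        subsingleton_of_forall_eq 0 (D.hom_std_costd_eq_zero hij)
      exact e.symm.toEquiv.subsingleton
    | succ r => exact ext_subsingleton_of_abelian _ _ r (D.ext_succ_eq_zero hhw i j r)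
  refine ⟨h1, h2, ?_⟩
  rw [finsum_eq_single _ 0]
  · split_ifs with h
    · obtain ⟨e⟩ := h1 h
      rw [e.finrank_eq, Module.finrank_self]
      simp
    · have := h2 0 (fun h' => h h'.1)
      rw [Module.finrank_zero_of_subsingleton]
      simp
  · intro r hr
    have := h2 r (fun h' => hr h'.2)
    rw [Module.finrank_zero_of_subsingleton]
    simp

end HWPaper
end
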